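/- arXiv:1304.3392 — 2 statements merged into one kernel-verified Lean document; each statement's English description precedes it below -/
import Mathlib

section
/- Let μ be a rotation-invariant, locally finite measure on ℝⁿ with radial density, essentially constant over dyadic annuli with constant β, let p > 1, and assume the weighted maximal inequalities ‖Mf‖_{Lᵖ(w)} ≤ W₁‖f‖_{Lᵖ(w)} and ‖Mf‖_{Lᵖ(w^{1−p})} ≤ W₂‖f‖_{Lᵖ(w^{1−p})}. Then ‖M_μ f‖_{Lᵖ(μ)} ≤ C ‖f‖_{Lᵖ(μ)}, where C depends only on β, W₁, W₂ and p. -/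
open MeasureTheory Metric
open scoped ENNReal

/-- The centered maximal function of `g` at `x` with respect to a measure `ν` on `ℝⁿ`. -/
noncomputable def centeredMax (n : ℕ) (ν : Measure (EuclideanSpace ℝ (Fin n)))
    (g : EuclideanSpace ℝ (Fin n) → ℝ) (x : EuclideanSpace ℝ (Fin n)) : ℝ≥0∞ :=
  ⨆ (r : ℝ) (_ : 0 < r), (ν (ball x r))⁻¹ * ∫⁻ y in ball x r, ‖g y‖₊ ∂ν

/-- The Hardy type operator over balls centered at the origin. -/
noncomputable def hardyMax (n : ℕ) (ν : Measure (EuclideanSpace ℝ (Fin n)))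
    (F : EuclideanSpace ℝ (Fin n) → ℝ≥0∞) (x : EuclideanSpace ℝ (Fin n)) : ℝ≥0∞ :=
  ⨆ (R : ℝ) (_ : ‖x‖ < R), (ν (ball 0 R))⁻¹ * ∫⁻ y in ball 0 R, F y ∂ν

lemma hardy_set (n : ℕ) (ν : Measure (EuclideanSpace ℝ (Fin n)))
    (F : EuclideanSpace ℝ (Fin n) → ℝ≥0∞) (a : ℝ≥0∞) :
    {x | a < hardyMax n ν F x} =
      ⋃ R ∈ {R : ℝ | a < (ν (ball 0 R))⁻¹ * ∫⁻ y in ball 0 R, F y ∂ν}, ball 0 R := by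
  ext x
  simp only [hardyMax, Set.mem_ofPred_eq, lt_iSup_iff, Set.mem_iUnion, mem_ball_zero_iff]
  constructor
  · rintro ⟨R, h1, h2⟩; exact ⟨R, h2, h1⟩
  · rintro ⟨R, h1, h2⟩; exact ⟨R, h2, h1⟩

lemma hardy_measurable (n : ℕ) (ν : Measure (EuclideanSpace ℝ (Fin n)))
    (F : EuclideanSpace ℝ (Fin n) → ℝ≥0∞) : Measurable (hardyMax n ν F) := by
  refine measurable_of_Ioi fun a => ?_
  have : hardyMax n ν F ⁻¹' Set.Ioi a = {x | a < hardyMax n ν F x} := rfl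
  rw [this, hardy_set]
  exact (isOpen_biUnion fun _ _ => isOpen_ball).measurableSet

lemma hardy_weak (n : ℕ) (ν : Measure (EuclideanSpace ℝ (Fin n)))
    (F : EuclideanSpace ℝ (Fin n) → ℝ) (hF : Measurable F)
    (t : ℝ) (ht : 0 < t) :
    ν {x | ENNReal.ofReal t < hardyMax n ν (fun y => ENNReal.ofReal (F y)) x} ≤
      ENNReal.ofReal (2 / t) * ∫⁻ x in {x | t < 2 * F x}, ENNReal.ofReal (F x) ∂ν := by
  rw [hardy_set]
  set A := {R : ℝ | ENNReal.ofReal t < (ν (ball 0 R))⁻¹ *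
    ∫⁻ y in ball 0 R, ENNReal.ofReal (F y) ∂ν} with hA
  obtain ⟨T, hTA, hTc, hT⟩ := TopologicalSpace.isOpen_biUnion_countable A
    (fun R => ball (0 : EuclideanSpace ℝ (Fin n)) R) (fun _ _ => isOpen_ball)
  rw [← hT, measure_biUnion_eq_iSup hTc]
  swap
  · intro a ha b hb
    rcases le_total a b with h | h
    · exact ⟨b, hb, ball_subset_ball h, subset_rfl⟩
    · exact ⟨a, ha, subset_rfl, ball_subset_ball h⟩
  refine iSup₂_le fun R hR => ?_
  have hR := hTA hR
  simp only [hA, Set.mem_ofPred_eq] at hR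
  set c := ν (ball 0 R) with hc
  have hcT : c ≠ ∞ := by
    intro h; rw [h] at hR; simp at hR
  have hm : MeasurableSet {x | t < 2 * F x} := measurableSet_lt measurable_const (hF.const_mul 2)
  have h1 : ENNReal.ofReal t * c ≤ ∫⁻ y in ball 0 R, ENNReal.ofReal (F y) ∂ν := by
    rw [← ENNReal.div_eq_inv_mul] at hR
    exact ENNReal.mul_le_of_le_div hR.le
  have h2 : ∫⁻ y in ball 0 R, ENNReal.ofReal (F y) ∂ν ≤
      ENNReal.ofReal (t/2) * c + ∫⁻ x in {x | t < 2 * F x}, ENNReal.ofReal (F x) ∂ν := by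
    calc ∫⁻ y in ball 0 R, ENNReal.ofReal (F y) ∂ν
        ≤ ∫⁻ y in ball 0 R, (ENNReal.ofReal (t/2) +
          {x | t < 2 * F x}.indicator (fun x => ENNReal.ofReal (F x)) y) ∂ν := by
          refine lintegral_mono fun y => ?_
          by_cases hy : t < 2 * F y
          · rw [Set.indicator_of_mem (by exact hy)]; exact le_add_self
          · rw [Set.indicator_of_notMem (by exact hy), add_zero]
            exact ENNReal.ofReal_le_ofReal (by linarith)
      _ = ENNReal.ofReal (t/2) * c + ∫⁻ y in ball 0 R, 
          {x | t < 2 * F x}.indicator (fun x => ENNReal.ofReal (F x)) y ∂ν := by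
          rw [lintegral_add_left measurable_const, setLIntegral_const]
      _ ≤ _ := by
          refine add_le_add le_rfl ?_
          refine (setLIntegral_le_lintegral _ _).trans ?_
          rw [lintegral_indicator hm]
  have h3 : ENNReal.ofReal t * c = ENNReal.ofReal (t/2) * c + ENNReal.ofReal (t/2) * c := by
    rw [← add_mul, ← ENNReal.ofReal_add (by positivity) (by positivity)]; simp
  rw [h3] at h1
  have h4 := (ENNReal.add_le_add_iff_left (ENNReal.mul_ne_top ENNReal.ofReal_ne_top hcT)).1
    (h1.trans h2)
  calc c = ENNReal.ofReal (2/t) * (ENNReal.ofReal (t/2) * c) := by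
        rw [← mul_assoc, ← ENNReal.ofReal_mul (by positivity)]
        rw [show 2 / t * (t/2) = 1 by field_simp]; simp
    _ ≤ _ := by gcongr

lemma strong_of_weak {α : Type*} [MeasurableSpace α] (ν : Measure α) (p : ℝ) (hp : 1 < p)
    (F : α → ℝ) (hF : Measurable F) (hF0 : ∀ x, 0 ≤ F x) (G : α → ℝ≥0∞) (hG : Measurable G)
    (h : ∀ t : ℝ, 0 < t → ν {x | ENNReal.ofReal t < G x} ≤
      ENNReal.ofReal (2 / t) * ∫⁻ x in {x | t < 2 * F x}, ENNReal.ofReal (F x) ∂ν) :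
    ∫⁻ x, G x ^ p ∂ν ≤ ENNReal.ofReal (2 * p / (p - 1) * 2 ^ (p - 1)) *
      ∫⁻ x, ENNReal.ofReal (F x) ^ p ∂ν := by
  have hp1 : 0 < p - 1 := by linarith
  set ρ := ν.withDensity (fun x => ENNReal.ofReal (F x)) with hρ
  have hms : ∀ t : ℝ, MeasurableSet {x | t < 2 * F x} :=
    fun t => measurableSet_lt measurable_const (hF.const_mul 2)
  -- right-hand side
  have hR : ∫⁻ x, ENNReal.ofReal ((2 * F x) ^ (p - 1)) ∂ρ =
      ENNReal.ofReal (2 ^ (p-1)) * ∫⁻ x, ENNReal.ofReal (F x) ^ p ∂ν := by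
    rw [hρ, lintegral_withDensity_eq_lintegral_mul _ hF.ennreal_ofReal (by fun_prop),
      ← lintegral_const_mul _ (by fun_prop)]
    refine lintegral_congr fun x => ?_
    simp only [Pi.mul_apply]
    rw [ENNReal.ofReal_rpow_of_nonneg (hF0 x) (by linarith), ← ENNReal.ofReal_mul (hF0 x),
      ← ENNReal.ofReal_mul (by positivity), Real.mul_rpow (by norm_num) (hF0 x)]
    congr 1
    have : F x ^ p = F x * F x ^ (p-1) := by
      conv_lhs => rw [show p = 1 + (p - 1) by ring]
      rw [Real.rpow_add' (hF0 x) (by linarith), Real.rpow_one]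
    rw [this]; ring
  have hR2 := lintegral_rpow_eq_lintegral_meas_lt_mul ρ (f := fun x => 2 * F x)
    (Filter.Eventually.of_forall fun x => mul_nonneg (by norm_num) (hF0 x))
    (hF.const_mul 2).aemeasurable hp1
  rw [hR] at hR2
  have key : ∀ N : ℕ, ∫⁻ x, (min (G x) N) ^ p ∂ν ≤
      ENNReal.ofReal (2 * p / (p - 1) * 2 ^ (p - 1)) * ∫⁻ x, ENNReal.ofReal (F x) ^ p ∂ν := by
    intro N
    have hfin : ∀ x, min (G x) N ≠ ∞ := fun x => 
      ne_top_of_le_ne_top (ENNReal.natCast_ne_top N) (min_le_right _ _)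
    have e1 : ∫⁻ x, (min (G x) N) ^ p ∂ν = ∫⁻ x, ENNReal.ofReal ((min (G x) N).toReal ^ p) ∂ν := by
      refine lintegral_congr fun x => ?_
      rw [← ENNReal.ofReal_rpow_of_nonneg ENNReal.toReal_nonneg (by linarith),
        ENNReal.ofReal_toReal (hfin x)]
    rw [e1, lintegral_rpow_eq_lintegral_meas_lt_mul ν
      (Filter.Eventually.of_forall fun x => ENNReal.toReal_nonneg)
      (hG.min measurable_const).ennreal_toReal.aemeasurable (by linarith)]
    have e2 : ∫⁻ t in Set.Ioi (0:ℝ), ν {x | t < (min (G x) N).toReal} * ENNReal.ofReal (t ^ (p - 1))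
        ≤ ∫⁻ t in Set.Ioi (0:ℝ), ENNReal.ofReal 2 * 
          (ρ {x | t < 2 * F x} * ENNReal.ofReal (t ^ (p - 1 - 1))) := by
      refine setLIntegral_mono' measurableSet_Ioi fun t ht => ?_
      have ht : 0 < t := ht
      have : ν {x | t < (min (G x) N).toReal} ≤ ENNReal.ofReal (2 / t) * ρ {x | t < 2 * F x} := by
        rw [hρ, withDensity_apply _ (hms t)]
        refine le_trans (measure_mono fun x hx => ?_) (h t ht)
        have hx : t < (min (G x) N).toReal := hx
        exact ((ENNReal.ofReal_lt_iff_lt_toReal ht.le (hfin x)).2 hx).trans_le (min_le_left _ _)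
      calc _ ≤ ENNReal.ofReal (2 / t) * ρ {x | t < 2 * F x} * ENNReal.ofReal (t ^ (p - 1)) := by gcongr
        _ = (ENNReal.ofReal (2 / t) * ENNReal.ofReal (t ^ (p - 1))) * ρ {x | t < 2 * F x} := by ring
        _ = (ENNReal.ofReal 2 * ENNReal.ofReal (t ^ (p - 1 - 1))) * ρ {x | t < 2 * F x} := by
          rw [← ENNReal.ofReal_mul (by positivity), ← ENNReal.ofReal_mul (by positivity),
            Real.rpow_sub_one ht.ne' (p-1)]
          congr 2; field_simp
        _ = _ := by ring
    have e3 : ∫⁻ t in Set.Ioi (0:ℝ), ρ {x | t < 2 * F x} * ENNReal.ofReal (t ^ (p - 1 - 1)) =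
        ENNReal.ofReal (1/(p-1)) * (ENNReal.ofReal (2 ^ (p - 1)) * ∫⁻ x, ENNReal.ofReal (F x) ^ p ∂ν) := by
      rw [hR2, ← mul_assoc, ← ENNReal.ofReal_mul (by positivity)]
      rw [show 1 / (p-1) * (p-1) = 1 by field_simp]; simp
    calc _ ≤ ENNReal.ofReal p * _ := mul_le_mul_right e2 _
      _ = _ := by
        rw [lintegral_const_mul' _ _ ENNReal.ofReal_ne_top, e3]
        simp only [← mul_assoc]
        rw [← ENNReal.ofReal_mul (by positivity), ← ENNReal.ofReal_mul (by positivity), 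
          ← ENNReal.ofReal_mul (by positivity)]
        congr 2; ring
  have hsup : ∀ x, G x ^ p = ⨆ N : ℕ, (min (G x) N) ^ p := by
    intro x
    apply le_antisymm
    · by_cases hx : G x = ∞
      · simp only [hx, min_eq_right le_top]
        rw [ENNReal.top_rpow_of_pos (by linarith)]
        have : Filter.Tendsto (fun N : ℕ => ((N : ℝ≥0∞)) ^ p) Filter.atTop (nhds ∞) := by
          have := ((ENNReal.continuous_rpow_const (y := p)).tendsto ∞).comp
            ENNReal.tendsto_nat_nhds_top
          rwa [ENNReal.top_rpow_of_pos (by linarith)] at this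
        exact le_of_tendsto' this fun N => le_iSup (fun N : ℕ => ((N : ℝ≥0∞)) ^ p) N
      · obtain ⟨N, hN⟩ := ENNReal.exists_nat_gt hx
        refine le_iSup_of_le N ?_
        rw [min_eq_left hN.le]
    · exact iSup_le fun N => ENNReal.rpow_le_rpow (min_le_left _ _) (by linarith)
  simp_rw [hsup]
  rw [lintegral_iSup (fun N => (hG.min measurable_const).pow_const p)]
  · exact iSup_le key
  · intro a b hab x
    dsimp only
    have : (a : ℝ≥0∞) ≤ b := by exact_mod_cast hab
    exact ENNReal.rpow_le_rpow (min_le_min_left _ this) (by linarith)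

lemma max_measurable (n : ℕ) (g : EuclideanSpace ℝ (Fin n) → ℝ) :
    Measurable (centeredMax n volume g) := by
  refine measurable_of_Ioi fun a => IsOpen.measurableSet ?_
  rw [Metric.isOpen_iff]
  intro x hx
  simp only [centeredMax, Set.mem_preimage, Set.mem_Ioi, lt_iSup_iff] at hx
  obtain ⟨r, hr, hx⟩ := hx
  have hU : ball x r = ⋃ k : ℕ, ball x (r - 1 / ((k : ℝ) + 1)) := by
    ext y
    simp only [Set.mem_iUnion, mem_ball]
    constructor
    · intro hy
      obtain ⟨k, hk⟩ := exists_nat_one_div_lt (sub_pos.2 hy)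
      exact ⟨k, by linarith⟩
    · rintro ⟨k, hk⟩
      have : 0 < 1 / ((k : ℝ) + 1) := by positivity
      linarith
  have hmono : Monotone fun k : ℕ => ball x (r - 1 / ((k : ℝ) + 1)) := by
    intro a b hab
    refine ball_subset_ball ?_
    have : (a : ℝ) ≤ b := by exact_mod_cast hab
    have : 1 / ((b : ℝ) + 1) ≤ 1 / ((a : ℝ) + 1) := by gcongr
    linarith
  have hI : ∫⁻ y in ball x r, (‖g y‖₊ : ℝ≥0∞) =
      ⨆ k : ℕ, ∫⁻ y in ball x (r - 1 / ((k : ℝ) + 1)), (‖g y‖₊ : ℝ≥0∞) := by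
    conv_lhs => rw [hU]
    exact setLIntegral_iUnion_of_directed _ hmono.directed_le
  rw [hI, ENNReal.mul_iSup, lt_iSup_iff] at hx
  obtain ⟨k, hk⟩ := hx
  refine ⟨1 / ((k : ℝ) + 1), by positivity, fun z hz => ?_⟩
  simp only [centeredMax, Set.mem_preimage, Set.mem_Ioi, lt_iSup_iff]
  refine ⟨r, hr, hk.trans_le ?_⟩
  rw [Measure.addHaar_ball_center volume x, Measure.addHaar_ball_center volume z]
  refine mul_le_mul_right (lintegral_mono_set ?_) _
  refine ball_subset_ball' ?_
  rw [mem_ball, dist_comm] at hz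
  linarith

lemma ball_annulus (n : ℕ) (hn : n ≠ 0) (x : EuclideanSpace ℝ (Fin n)) (r : ℝ) (hr : 0 < r) :
    volume (ball x r) ≤ 2 * volume (ball x r \ ball (0 : EuclideanSpace ℝ (Fin n)) (r / 4)) := by
  have h1 : volume (ball (0 : EuclideanSpace ℝ (Fin n)) (r / 4)) ≤
      ENNReal.ofReal (1/2) * volume (ball x r) := by
    rw [show r / 4 = (1/4) * r by ring, Measure.addHaar_ball_mul_of_pos volume _ (by norm_num),
      Measure.addHaar_ball_center volume x, finrank_euclideanSpace, Fintype.card_fin]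
    gcongr
    calc ((1:ℝ)/4) ^ n ≤ (1/4) ^ 1 := pow_le_pow_of_le_one (by norm_num) (by norm_num) (by omega)
      _ ≤ _ := by norm_num
  have h2 : volume (ball x r) ≤ volume (ball (0 : EuclideanSpace ℝ (Fin n)) (r / 4)) +
      volume (ball x r \ ball (0 : EuclideanSpace ℝ (Fin n)) (r / 4)) := by
    refine (measure_mono ?_).trans (measure_union_le _ _)
    intro y hy
    by_cases h : y ∈ ball (0 : EuclideanSpace ℝ (Fin n)) (r / 4)
    · exact Or.inl h
    · exact Or.inr ⟨hy, h⟩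
  have h3 : volume (ball x r) = ENNReal.ofReal (1/2) * volume (ball x r) +
      ENNReal.ofReal (1/2) * volume (ball x r) := by
    rw [← add_mul, ← ENNReal.ofReal_add (by norm_num) (by norm_num)]; norm_num
  have hf : volume (ball x r) ≠ ∞ := measure_ball_lt_top.ne
  have h4 : ENNReal.ofReal (1/2) * volume (ball x r) +
      ENNReal.ofReal (1/2) * volume (ball x r) ≤ ENNReal.ofReal (1/2) * volume (ball x r) +
      volume (ball x r \ ball (0 : EuclideanSpace ℝ (Fin n)) (r / 4)) := by
    rw [← h3]; exact h2.trans (add_le_add h1 le_rfl)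
  have h5 := (ENNReal.add_le_add_iff_left (ENNReal.mul_ne_top ENNReal.ofReal_ne_top hf)).1 h4
  rw [h3, two_mul]
  exact add_le_add h5 h5

lemma weight_ball (n : ℕ) (hn : n ≠ 0) (v : EuclideanSpace ℝ (Fin n) → ℝ) (L : ℝ) (hL : 0 ≤ L)
    (x y : EuclideanSpace ℝ (Fin n)) (r : ℝ) (hr : 0 < r)
    (h : ∀ z ∈ ball x r \ ball (0 : EuclideanSpace ℝ (Fin n)) (r / 4), v y ≤ L * v z) :
    ENNReal.ofReal (v y) * volume (ball x r) ≤ ENNReal.ofReal (2 * L) *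
      (volume.withDensity (fun x => ENNReal.ofReal (v x))) (ball x r) := by
  have hm : MeasurableSet (ball x r \ ball (0 : EuclideanSpace ℝ (Fin n)) (r / 4)) :=
    measurableSet_ball.diff measurableSet_ball
  set A := ball x r \ ball (0 : EuclideanSpace ℝ (Fin n)) (r / 4)
  calc _ ≤ ENNReal.ofReal (v y) * (2 * volume A) := mul_le_mul_right (ball_annulus n hn x r hr) _
    _ = 2 * ∫⁻ z in A, ENNReal.ofReal (v y) := by rw [setLIntegral_const]; ring
    _ ≤ 2 * ∫⁻ z in A, ENNReal.ofReal L * ENNReal.ofReal (v z) := by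
        refine mul_le_mul_right (setLIntegral_mono' hm fun z hz => ?_) _
        rw [← ENNReal.ofReal_mul hL]
        exact ENNReal.ofReal_le_ofReal (h z hz)
    _ = ENNReal.ofReal (2 * L) * ∫⁻ z in A, ENNReal.ofReal (v z) := by
        rw [lintegral_const_mul' _ _ ENNReal.ofReal_ne_top, ENNReal.ofReal_mul (by norm_num)]
        simp [mul_assoc]
    _ ≤ _ := by
        refine mul_le_mul_right ?_ _
        rw [withDensity_apply _ measurableSet_ball]
        exact lintegral_mono_set Set.sdiff_subset

lemma pointwise_bound (n : ℕ) (v : EuclideanSpace ℝ (Fin n) → ℝ) (L : ℝ) (hL : 0 ≤ L)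
    (hv : Measurable v) (hv0 : ∀ x, 0 < v x)
    (hvL : ∀ x y, 0 < ‖x‖ → ‖x‖ ≤ 8 * ‖y‖ → ‖y‖ ≤ 8 * ‖x‖ → v x ≤ L * v y)
    (f : EuclideanSpace ℝ (Fin n) → ℝ) (hf : Measurable f) (x : EuclideanSpace ℝ (Fin n)) :
    centeredMax n (volume.withDensity (fun x => ENNReal.ofReal (v x))) f x ≤
      ENNReal.ofReal (2 * L) * ((ENNReal.ofReal (v x))⁻¹ *
        centeredMax n volume (fun y => f y * v y) x) +
      (ENNReal.ofReal (2 * L) * centeredMax n volume f x +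
      hardyMax n (volume.withDensity (fun x => ENNReal.ofReal (v x)))
        (fun y => ENNReal.ofReal ‖f y‖) x) := by
  set ν := volume.withDensity (fun x => ENNReal.ofReal (v x)) with hν
  refine iSup₂_le fun r hr => ?_
  have hvolT : volume (ball x r) ≠ ∞ := measure_ball_lt_top.ne
  have hvol0 : volume (ball x r) ≠ 0 := (measure_ball_pos volume x hr).ne'
  have hI : ∀ s, MeasurableSet s → ∫⁻ y in s, (‖f y‖₊ : ℝ≥0∞) ∂ν =
      ∫⁻ y in s, (‖f y * v y‖₊ : ℝ≥0∞) := by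
    intro s hs
    rw [hν, setLIntegral_withDensity_eq_setLIntegral_mul _ hv.ennreal_ofReal (by fun_prop) hs]
    refine lintegral_congr fun y => ?_
    simp only [Pi.mul_apply]
    rw [nnnorm_mul, ENNReal.coe_mul, mul_comm]
    congr 1
    rw [← enorm_eq_nnnorm, Real.enorm_of_nonneg (hv0 y).le]
  have hn0 : ∀ {z : EuclideanSpace ℝ (Fin n)}, 0 < ‖z‖ → n ≠ 0 := by
    rintro z hz rfl
    rw [Subsingleton.elim z 0] at hz; simp at hz
  rcases le_or_gt r (2 * ‖x‖) with hrx | hrx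
  · -- near case
    have hx0 : 0 < ‖x‖ := by linarith
    refine le_trans ?_ le_self_add
    have hw := weight_ball n (hn0 hx0) v L hL x x r hr (by
      rintro z ⟨hz1, hz2⟩
      rw [mem_ball, dist_eq_norm] at hz1
      rw [mem_ball_zero_iff, not_lt] at hz2
      have a1 : ‖z‖ ≤ ‖z - x‖ + ‖x‖ := by simpa using norm_add_le (z - x) x
      have a2 : ‖x‖ ≤ ‖z - x‖ + ‖z‖ := by
        have := norm_sub_norm_le x z; rw [norm_sub_rev] at this; linarith
      refine hvL x z hx0 ?_ (by linarith)
      rcases le_total r (‖x‖ / 2) with h | h <;> linarith)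
    have hu0 : ENNReal.ofReal (v x) ≠ 0 := by simpa using hv0 x
    have hinv : (ν (ball x r))⁻¹ ≤ ENNReal.ofReal (2 * L) * ((ENNReal.ofReal (v x))⁻¹ *
        (volume (ball x r))⁻¹) := by
      rw [← ENNReal.mul_inv (Or.inl hu0) (Or.inl ENNReal.ofReal_ne_top), ← div_eq_mul_inv]
      rw [ENNReal.le_div_iff_mul_le (Or.inl (mul_ne_zero hu0 hvol0))
        (Or.inl (ENNReal.mul_ne_top ENNReal.ofReal_ne_top hvolT))]
      refine (mul_le_mul_right hw _).trans ?_
      rw [mul_left_comm]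
      exact (mul_le_mul_right (ENNReal.inv_mul_le_one _) _).trans (by rw [mul_one])
    rw [hI _ measurableSet_ball]
    calc _ ≤ ENNReal.ofReal (2 * L) * ((ENNReal.ofReal (v x))⁻¹ *
        (volume (ball x r))⁻¹) * ∫⁻ y in ball x r, (‖f y * v y‖₊ : ℝ≥0∞) := mul_le_mul_left hinv _
      _ = ENNReal.ofReal (2 * L) * ((ENNReal.ofReal (v x))⁻¹ *
        ((volume (ball x r))⁻¹ * ∫⁻ y in ball x r, (‖f y * v y‖₊ : ℝ≥0∞))) := by ring
      _ ≤ _ := by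
        refine mul_le_mul_right (mul_le_mul_right ?_ _) _
        exact le_iSup₂_of_le (f := fun (r : ℝ) (_ : 0 < r) => (volume (ball x r))⁻¹ *
          ∫⁻ y in ball x r, (‖f y * v y‖₊ : ℝ≥0∞)) r hr le_rfl
  · -- far case
    refine le_trans ?_ le_add_self
    set R := r - ‖x‖ with hR
    have hsub : ball (0 : EuclideanSpace ℝ (Fin n)) R ⊆ ball x r := by
      refine ball_subset_ball' ?_
      rw [dist_zero_left]; linarith
    have hsplit : ∫⁻ y in ball x r, (‖f y‖₊ : ℝ≥0∞) ∂ν =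
        ∫⁻ y in ball x r \ ball 0 R, (‖f y‖₊ : ℝ≥0∞) ∂ν +
        ∫⁻ y in ball 0 R, (‖f y‖₊ : ℝ≥0∞) ∂ν := by
      rw [← lintegral_inter_add_sdiff (fun y => (‖f y‖₊ : ℝ≥0∞)) (ball x r)
        (measurableSet_ball (x := (0 : EuclideanSpace ℝ (Fin n))) (ε := R)),
        Set.inter_eq_right.2 hsub, add_comm]
    rw [hsplit, mul_add]
    refine add_le_add ?_ ?_
    · rw [hI _ (measurableSet_ball.diff measurableSet_ball)]
      have hbd : ∀ y ∈ ball x r \ ball (0 : EuclideanSpace ℝ (Fin n)) R,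
          (‖f y * v y‖₊ : ℝ≥0∞) ≤ (ENNReal.ofReal (2 * L) * ν (ball x r) * (volume (ball x r))⁻¹) *
            (‖f y‖₊ : ℝ≥0∞) := by
        rintro y ⟨hy1, hy2⟩
        rw [mem_ball, dist_eq_norm] at hy1
        rw [mem_ball_zero_iff, not_lt] at hy2
        have b1 : ‖y‖ ≤ ‖y - x‖ + ‖x‖ := by simpa using norm_add_le (y - x) x
        have hy0 : 0 < ‖y‖ := by linarith
        have hw := weight_ball n (hn0 hy0) v L hL x y r hr (by
          rintro z ⟨hz1, hz2⟩
          rw [mem_ball, dist_eq_norm] at hz1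
          rw [mem_ball_zero_iff, not_lt] at hz2
          have a1 : ‖z‖ ≤ ‖z - x‖ + ‖x‖ := by simpa using norm_add_le (z - x) x
          exact hvL y z hy0 (by linarith) (by linarith))
        rw [nnnorm_mul, ENNReal.coe_mul, mul_comm]
        refine mul_le_mul_left ?_ _
        rw [← enorm_eq_nnnorm, Real.enorm_of_nonneg (hv0 y).le, ← div_eq_mul_inv,
          ENNReal.le_div_iff_mul_le (Or.inl hvol0) (Or.inl hvolT)]
        exact hw
      calc _ ≤ (ν (ball x r))⁻¹ * ∫⁻ y in ball x r \ ball 0 R,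
            (ENNReal.ofReal (2 * L) * ν (ball x r) * (volume (ball x r))⁻¹) * (‖f y‖₊ : ℝ≥0∞) :=
            mul_le_mul_right (setLIntegral_mono' (measurableSet_ball.diff measurableSet_ball) hbd) _
        _ = ((ν (ball x r))⁻¹ * ν (ball x r)) * (ENNReal.ofReal (2 * L) *
            ((volume (ball x r))⁻¹ * ∫⁻ y in ball x r \ ball 0 R, (‖f y‖₊ : ℝ≥0∞))) := by
            rw [lintegral_const_mul _ (by fun_prop)]; ring
        _ ≤ 1 * (ENNReal.ofReal (2 * L) *
            ((volume (ball x r))⁻¹ * ∫⁻ y in ball x r, (‖f y‖₊ : ℝ≥0∞))) := by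
            refine mul_le_mul' (ENNReal.inv_mul_le_one _) ?_
            exact mul_le_mul_right (mul_le_mul_right (lintegral_mono_set Set.sdiff_subset) _) _
        _ ≤ _ := by
            rw [one_mul]
            refine mul_le_mul_right ?_ _
            exact le_iSup₂_of_le (f := fun (r : ℝ) (_ : 0 < r) => (volume (ball x r))⁻¹ *
              ∫⁻ y in ball x r, (‖f y‖₊ : ℝ≥0∞)) r hr le_rfl
    · simp only [hardyMax, ofReal_norm, enorm_eq_nnnorm]
      refine le_iSup₂_of_le (f := fun (R : ℝ) (_ : ‖x‖ < R) => (ν (ball 0 R))⁻¹ *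
        ∫⁻ y in ball 0 R, (‖f y‖₊ : ℝ≥0∞) ∂ν) R (by linarith) ?_
      exact mul_le_mul_left (ENNReal.inv_le_inv.2 (measure_mono hsub)) _

lemma core_meas (p L : ℝ) (hp : 1 < p) (hL : 0 ≤ L) (A₁ A₂ : ℝ≥0∞) (n : ℕ)
    (v : EuclideanSpace ℝ (Fin n) → ℝ) (hv : Measurable v) (hv0 : ∀ x, 0 < v x)
    (hvL : ∀ x y, 0 < ‖x‖ → ‖x‖ ≤ 8 * ‖y‖ → ‖y‖ ≤ 8 * ‖x‖ → v x ≤ L * v y)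
    (h1 : ∀ f : EuclideanSpace ℝ (Fin n) → ℝ,
        ∫⁻ x, centeredMax n volume f x ^ p * ENNReal.ofReal (v x)
          ≤ A₁ * ∫⁻ x, (‖f x‖₊ : ℝ≥0∞) ^ p * ENNReal.ofReal (v x))
    (h2 : ∀ f : EuclideanSpace ℝ (Fin n) → ℝ,
        ∫⁻ x, centeredMax n volume f x ^ p * ENNReal.ofReal (v x ^ (1 - p))
          ≤ A₂ * ∫⁻ x, (‖f x‖₊ : ℝ≥0∞) ^ p * ENNReal.ofReal (v x ^ (1 - p)))
    (f : EuclideanSpace ℝ (Fin n) → ℝ) (hf : Measurable f) :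
    ∫⁻ x, centeredMax n (volume.withDensity (fun x => ENNReal.ofReal (v x))) f x ^ p
      ∂(volume.withDensity (fun x => ENNReal.ofReal (v x))) ≤
    (2 ^ (p - 1) * (ENNReal.ofReal (2 * L) ^ p * A₂ + 2 ^ (p - 1) * (ENNReal.ofReal (2 * L) ^ p * A₁ +
      ENNReal.ofReal (2 * p / (p - 1) * 2 ^ (p - 1))))) *
      ∫⁻ x, (‖f x‖₊ : ℝ≥0∞) ^ p ∂(volume.withDensity (fun x => ENNReal.ofReal (v x))) := by
  set D := ENNReal.ofReal (2 * L) with hD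
  set ν := volume.withDensity (fun x => ENNReal.ofReal (v x)) with hν
  have hp0 : 0 ≤ p := by linarith
  set I := ∫⁻ x, (‖f x‖₊ : ℝ≥0∞) ^ p ∂ν with hI
  have hIv : I = ∫⁻ x, (‖f x‖₊ : ℝ≥0∞) ^ p * ENNReal.ofReal (v x) := by
    rw [hI, hν, lintegral_withDensity_eq_lintegral_mul _ hv.ennreal_ofReal (by fun_prop)]
    refine lintegral_congr fun x => ?_
    simp only [Pi.mul_apply]; rw [mul_comm]
  have hu0 : ∀ x, ENNReal.ofReal (v x) ≠ 0 := fun x => by simpa using hv0 x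
  set X : EuclideanSpace ℝ (Fin n) → ℝ≥0∞ := fun x => D * ((ENNReal.ofReal (v x))⁻¹ *
        centeredMax n volume (fun y => f y * v y) x) with hX
  set Y : EuclideanSpace ℝ (Fin n) → ℝ≥0∞ := fun x => D * centeredMax n volume f x with hY
  set Z : EuclideanSpace ℝ (Fin n) → ℝ≥0∞ := hardyMax n ν (fun y => ENNReal.ofReal ‖f y‖) with hZ
  have hXm : Measurable X :=
    (hv.ennreal_ofReal.inv.mul (max_measurable n _)).const_mul _
  have hYm : Measurable Y := (max_measurable n _).const_mul _
  have hZm : Measurable Z := hardy_measurable n ν _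
  have hpow : ∀ x, ENNReal.ofReal (v x ^ (1 - p)) =
      ENNReal.ofReal (v x) * (ENNReal.ofReal (v x))⁻¹ ^ p := by
    intro x
    rw [← ENNReal.ofReal_rpow_of_pos (hv0 x), ENNReal.inv_rpow, ← ENNReal.rpow_neg, sub_eq_add_neg,
      ENNReal.rpow_add _ _ (hu0 x) ENNReal.ofReal_ne_top, ENNReal.rpow_one]
  have iX : ∫⁻ x, X x ^ p ∂ν ≤ D ^ p * A₂ * I := by
    have e1 : ∫⁻ x, X x ^ p ∂ν = D ^ p * ∫⁻ x, centeredMax n volume (fun y => f y * v y) x ^ p *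
        ENNReal.ofReal (v x ^ (1 - p)) := by
      rw [hν, lintegral_withDensity_eq_lintegral_mul _ hv.ennreal_ofReal (hXm.pow_const p),
        ← lintegral_const_mul' _ _ (ENNReal.rpow_ne_top_of_nonneg hp0 ENNReal.ofReal_ne_top)]
      refine lintegral_congr fun x => ?_
      simp only [Pi.mul_apply, hX]
      rw [hpow, ENNReal.mul_rpow_of_nonneg _ _ hp0, ENNReal.mul_rpow_of_nonneg _ _ hp0]
      ring
    have e2 : ∫⁻ x, (‖f x * v x‖₊ : ℝ≥0∞) ^ p * ENNReal.ofReal (v x ^ (1 - p)) = I := by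
      rw [hIv]
      refine lintegral_congr fun x => ?_
      rw [hpow, nnnorm_mul, ENNReal.coe_mul, ENNReal.mul_rpow_of_nonneg _ _ hp0,
        ← enorm_eq_nnnorm (v x), Real.enorm_of_nonneg (hv0 x).le, ENNReal.inv_rpow]
      have : ENNReal.ofReal (v x) ^ p * (ENNReal.ofReal (v x) ^ p)⁻¹ = 1 :=
        ENNReal.mul_inv_cancel
          (by rw [Ne, ENNReal.rpow_eq_zero_iff]; simp [hu0 x])
          (ENNReal.rpow_ne_top_of_nonneg hp0 ENNReal.ofReal_ne_top)
      calc _ = (‖f x‖₊ : ℝ≥0∞) ^ p * ENNReal.ofReal (v x) *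
            (ENNReal.ofReal (v x) ^ p * (ENNReal.ofReal (v x) ^ p)⁻¹) := by ring
        _ = _ := by rw [this, mul_one]
    rw [e1, mul_assoc]
    refine mul_le_mul_right ((h2 _).trans ?_) _
    rw [e2]
  have iY : ∫⁻ x, Y x ^ p ∂ν ≤ D ^ p * A₁ * I := by
    have e1 : ∫⁻ x, Y x ^ p ∂ν = D ^ p * ∫⁻ x, centeredMax n volume f x ^ p *
        ENNReal.ofReal (v x) := by
      rw [hν, lintegral_withDensity_eq_lintegral_mul _ hv.ennreal_ofReal (hYm.pow_const p),
        ← lintegral_const_mul' _ _ (ENNReal.rpow_ne_top_of_nonneg hp0 ENNReal.ofReal_ne_top)]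
      refine lintegral_congr fun x => ?_
      simp only [Pi.mul_apply, hY]
      rw [ENNReal.mul_rpow_of_nonneg _ _ hp0]
      ring
    rw [e1, mul_assoc]
    refine mul_le_mul_right ((h1 _).trans ?_) _
    rw [hIv]
  have iZ : ∫⁻ x, Z x ^ p ∂ν ≤ ENNReal.ofReal (2 * p / (p - 1) * 2 ^ (p - 1)) * I := by
    have := strong_of_weak ν p hp (fun y => ‖f y‖) hf.norm (fun _ => norm_nonneg _) Z hZm
      (fun t ht => hardy_weak n ν _ hf.norm t ht)
    simpa only [ofReal_norm, enorm_eq_nnnorm] using this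
  have h2T : (2 : ℝ≥0∞) ^ (p - 1) ≠ ∞ := ENNReal.rpow_ne_top_of_nonneg (by linarith) (by simp)
  calc ∫⁻ x, centeredMax n ν f x ^ p ∂ν
      ≤ ∫⁻ x, 2 ^ (p - 1) * (X x ^ p + 2 ^ (p - 1) * (Y x ^ p + Z x ^ p)) ∂ν := by
        refine lintegral_mono fun x => ?_
        calc _ ≤ (X x + (Y x + Z x)) ^ p :=
              ENNReal.rpow_le_rpow (pointwise_bound n v L hL hv hv0 hvL f hf x) hp0
          _ ≤ 2 ^ (p - 1) * (X x ^ p + (Y x + Z x) ^ p) :=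
              ENNReal.rpow_add_le_mul_rpow_add_rpow _ _ hp.le
          _ ≤ _ := by
              gcongr
              exact ENNReal.rpow_add_le_mul_rpow_add_rpow _ _ hp.le
    _ = 2 ^ (p - 1) * (∫⁻ x, X x ^ p ∂ν + 2 ^ (p - 1) * (∫⁻ x, Y x ^ p ∂ν + ∫⁻ x, Z x ^ p ∂ν)) := by
        rw [lintegral_const_mul' _ _ h2T, lintegral_add_left (hXm.pow_const p),
          lintegral_const_mul' _ _ h2T, lintegral_add_left (hYm.pow_const p)]
    _ ≤ 2 ^ (p - 1) * (D ^ p * A₂ * I + 2 ^ (p - 1) * (D ^ p * A₁ * I +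
          ENNReal.ofReal (2 * p / (p - 1) * 2 ^ (p - 1)) * I)) := by gcongr
    _ = _ := by ring

lemma core_all (n : ℕ) (p : ℝ) (hp : 1 < p) (ν : Measure (EuclideanSpace ℝ (Fin n))) [SFinite ν]
    (C : ℝ≥0∞)
    (h : ∀ f : EuclideanSpace ℝ (Fin n) → ℝ, Measurable f →
      ∫⁻ x, centeredMax n ν f x ^ p ∂ν ≤ C * ∫⁻ x, (‖f x‖₊ : ℝ≥0∞) ^ p ∂ν)
    (f : EuclideanSpace ℝ (Fin n) → ℝ) :
      ∫⁻ x, centeredMax n ν f x ^ p ∂ν ≤ C * ∫⁻ x, (‖f x‖₊ : ℝ≥0∞) ^ p ∂ν := by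
  obtain ⟨g, hg, hgf, hgs⟩ := exists_measurable_le_forall_setLIntegral_eq (μ := ν)
    (fun x => (‖f x‖₊ : ℝ≥0∞))
  have hgT : ∀ x, g x ≠ ∞ := fun x => ne_top_of_le_ne_top ENNReal.coe_ne_top (hgf x)
  have hgn : ∀ x, (‖(g x).toReal‖₊ : ℝ≥0∞) = g x := by
    intro x
    rw [← enorm_eq_nnnorm, Real.enorm_of_nonneg ENNReal.toReal_nonneg, ENNReal.ofReal_toReal (hgT x)]
  have hM : ∀ x, centeredMax n ν f x = centeredMax n ν (fun x => (g x).toReal) x := by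
    intro x
    simp only [centeredMax, hgn, hgs]
  simp_rw [hM]
  refine (h _ hg.ennreal_toReal).trans (mul_le_mul_right (lintegral_mono fun x => ?_) _)
  rw [hgn]
  exact ENNReal.rpow_le_rpow (hgf x) (by linarith)

lemma weight_chain (w₀ : ℝ → ℝ) (β : ℝ) (hβ : 1 ≤ β)
    (h : ∀ R : ℝ, 0 < R → ∀ s ∈ Set.Icc R (2 * R), ∀ t ∈ Set.Icc R (2 * R), w₀ s ≤ β * w₀ t)
    (s t : ℝ) (hs : 0 < s) (h1 : s ≤ 8 * t) (h2 : t ≤ 8 * s) : w₀ s ≤ β ^ 3 * w₀ t := by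
  have hβ0 : 0 ≤ β := by linarith
  have step : ∀ a b c d : ℝ, w₀ a ≤ β * w₀ b → w₀ b ≤ β * w₀ c → w₀ c ≤ β * w₀ d →
      w₀ a ≤ β ^ 3 * w₀ d := by
    intro a b c d h1 h2 h3
    calc w₀ a ≤ β * w₀ b := h1
      _ ≤ β * (β * w₀ c) := by gcongr
      _ ≤ β * (β * (β * w₀ d)) := by gcongr
      _ = _ := by ring
  have ht : 0 < t := by linarith
  rcases le_total s t with hst | hst
  · have m1 : s ≤ min (2 * s) t := le_min (by linarith) hst
    have m2 : min (2 * s) t ≤ min (4 * s) t := min_le_min_right _ (by linarith)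
    have m3 : min (4 * s) t ≤ 2 * min (2 * s) t := by
      rcases le_total (2 * s) t with h | h
      · rw [min_eq_left h]; exact (min_le_left _ _).trans (by linarith)
      · rw [min_eq_right h]; exact (min_le_right _ _).trans (by linarith)
    have m4 : t ≤ 2 * min (4 * s) t := by
      rcases le_total (4 * s) t with h | h
      · rw [min_eq_left h]; linarith
      · rw [min_eq_right h]; linarith
    refine step s (min (2 * s) t) (min (4 * s) t) t ?_ ?_ ?_
    · exact h s hs _ ⟨le_rfl, by linarith⟩ _ ⟨m1, min_le_left _ _⟩
    · exact h _ (by linarith) _ ⟨le_rfl, by linarith⟩ _ ⟨m2, m3⟩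
    · exact h _ (by linarith) _ ⟨le_rfl, by linarith⟩ _ ⟨min_le_right _ _, m4⟩
  · have m1 : t ≤ min (2 * t) s := le_min (by linarith) hst
    have m2 : min (2 * t) s ≤ min (4 * t) s := min_le_min_right _ (by linarith)
    have m3 : min (4 * t) s ≤ 2 * min (2 * t) s := by
      rcases le_total (2 * t) s with h | h
      · rw [min_eq_left h]; exact (min_le_left _ _).trans (by linarith)
      · rw [min_eq_right h]; exact (min_le_right _ _).trans (by linarith)
    have m4 : s ≤ 2 * min (4 * t) s := by
      rcases le_total (4 * t) s with h | h
      · rw [min_eq_left h]; linarith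
      · rw [min_eq_right h]; linarith
    refine step s (min (4 * t) s) (min (2 * t) s) t ?_ ?_ ?_
    · exact h _ (by linarith) _ ⟨min_le_right _ _, m4⟩ _ ⟨le_rfl, by linarith⟩
    · exact h _ (by linarith) _ ⟨m2, m3⟩ _ ⟨le_rfl, by linarith⟩
    · exact h t ht _ ⟨m1, min_le_left _ _⟩ _ ⟨le_rfl, by linarith⟩

lemma exists_weight (w₀ : ℝ → ℝ) (β : ℝ) (hβ : 1 ≤ β) (hw : ∀ r : ℝ, 0 ≤ r → 0 < w₀ r)
    (h : ∀ R : ℝ, 0 < R → ∀ s ∈ Set.Icc R (2 * R), ∀ t ∈ Set.Icc R (2 * R), w₀ s ≤ β * w₀ t) :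
    ∃ v₀ : ℝ → ℝ, Measurable v₀ ∧ (∀ r, 0 ≤ r → v₀ r ≤ w₀ r ∧ w₀ r ≤ β ^ 2 * v₀ r) := by
  have hβ0 : 0 < β := by linarith
  refine ⟨fun r => if r = 0 then w₀ 0 else w₀ (2 ^ ⌊Real.logb 2 r⌋) / β, ?_, ?_⟩
  · refine Measurable.ite (measurableSet_singleton 0) measurable_const ?_
    have hfl : Measurable fun r : ℝ => ⌊Real.logb 2 r⌋ := by
      unfold Real.logb
      exact (Real.measurable_log.div_const _).floor
    exact (measurable_of_countable (fun k : ℤ => w₀ (2 ^ k) / β)).comp hfl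
  · intro r hr
    by_cases h0 : r = 0
    · subst h0
      have := hw 0 le_rfl
      simp only [if_true]
      exact ⟨le_rfl, le_mul_of_one_le_left this.le (one_le_pow₀ hβ)⟩
    · have hr0 : 0 < r := lt_of_le_of_ne hr (Ne.symm h0)
      simp only [h0, if_false]
      have hfl : ⌊Real.logb 2 r⌋ = Int.log 2 r := by
        exact_mod_cast Real.floor_logb_natCast (b := 2) hr
      rw [hfl]
      have a1 : (2 : ℝ) ^ Int.log 2 r ≤ r := by
        exact_mod_cast Int.zpow_log_le_self (b := 2) (by norm_num) hr0
      have a2 : r < (2 : ℝ) ^ (Int.log 2 r + 1) := by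
        exact_mod_cast Int.lt_zpow_succ_log_self (b := 2) (by norm_num) r
      rw [zpow_add_one₀ (by norm_num)] at a2
      set m := (2 : ℝ) ^ Int.log 2 r with hm
      have hm0 : 0 < m := by positivity
      constructor
      · rw [div_le_iff₀ hβ0, mul_comm]
        exact h m hm0 _ ⟨le_rfl, by linarith⟩ _ ⟨a1, by linarith⟩
      · have := h m hm0 r ⟨a1, by linarith⟩ m ⟨le_rfl, by linarith⟩
        calc w₀ r ≤ β * w₀ m := this
          _ = _ := by field_simp

/-- If a rotation invariant, locally finite measure `μ = w₀(|x|)dx` on `ℝⁿ` has density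
essentially constant over dyadic annuli with constant `β`, `p > 1`, and the Lebesgue
Hardy–Littlewood maximal operator `M` satisfies the weighted bounds
`‖Mf‖_{Lᵖ(w)} ≤ W₁ ‖f‖_{Lᵖ(w)}` and `‖Mf‖_{Lᵖ(w^{1-p})} ≤ W₂ ‖f‖_{Lᵖ(w^{1-p})}`, then
`‖M_μ f‖_{Lᵖ(μ)} ≤ C ‖f‖_{Lᵖ(μ)}`, with `C` depending only on `β, W₁, W₂, p`. -/
theorem stmt_12 (p β W₁ W₂ : ℝ) (hp : 1 < p) (hβ : 1 ≤ β) (hW₁ : 0 < W₁) (hW₂ : 0 < W₂) :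
    ∃ C : ℝ≥0∞, C ≠ ∞ ∧
      ∀ (n : ℕ) (w₀ : ℝ → ℝ), (∀ r : ℝ, 0 ≤ r → 0 < w₀ r) →
      (∀ R : ℝ, 0 < R → ∀ s ∈ Set.Icc R (2 * R), ∀ t ∈ Set.Icc R (2 * R),
        w₀ s ≤ β * w₀ t) →
      ∀ μ : Measure (EuclideanSpace ℝ (Fin n)),
      μ = volume.withDensity (fun x => ENNReal.ofReal (w₀ ‖x‖)) →
      IsLocallyFiniteMeasure μ →
      (∀ f : EuclideanSpace ℝ (Fin n) → ℝ,
        ∫⁻ x, centeredMax n volume f x ^ p * ENNReal.ofReal (w₀ ‖x‖)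
          ≤ ENNReal.ofReal (W₁ ^ p) *
            ∫⁻ x, (‖f x‖₊ : ℝ≥0∞) ^ p * ENNReal.ofReal (w₀ ‖x‖)) →
      (∀ f : EuclideanSpace ℝ (Fin n) → ℝ,
        ∫⁻ x, centeredMax n volume f x ^ p * ENNReal.ofReal (w₀ ‖x‖ ^ (1 - p))
          ≤ ENNReal.ofReal (W₂ ^ p) *
            ∫⁻ x, (‖f x‖₊ : ℝ≥0∞) ^ p * ENNReal.ofReal (w₀ ‖x‖ ^ (1 - p))) →
      ∀ f : EuclideanSpace ℝ (Fin n) → ℝ,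
        ∫⁻ x, centeredMax n μ f x ^ p ∂μ ≤ C * ∫⁻ x, (‖f x‖₊ : ℝ≥0∞) ^ p ∂μ := by
  set L := β ^ 5 with hLdef
  have hβ0 : 0 < β := by linarith
  have hL : 0 ≤ L := by positivity
  have hp0 : 0 ≤ p := by linarith
  set K := ENNReal.ofReal (β ^ 2) with hK
  set A₁ := ENNReal.ofReal (W₁ ^ p) * K with hA₁
  set A₂ := ENNReal.ofReal ((β ^ 2) ^ (p - 1)) * ENNReal.ofReal (W₂ ^ p) with hA₂
  set C₀ := (2 ^ (p - 1) * (ENNReal.ofReal (2 * L) ^ p * A₂ +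
    2 ^ (p - 1) * (ENNReal.ofReal (2 * L) ^ p * A₁ +
      ENNReal.ofReal (2 * p / (p - 1) * 2 ^ (p - 1))))) with hC₀
  have hKT : K ≠ ∞ := ENNReal.ofReal_ne_top
  have hKpT : K ^ p ≠ ∞ := ENNReal.rpow_ne_top_of_nonneg hp0 hKT
  have h2T : (2 : ℝ≥0∞) ^ (p - 1) ≠ ∞ := ENNReal.rpow_ne_top_of_nonneg (by linarith) (by simp)
  have hDT : ENNReal.ofReal (2 * L) ^ p ≠ ∞ :=
    ENNReal.rpow_ne_top_of_nonneg hp0 ENNReal.ofReal_ne_top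
  have hA₁T : A₁ ≠ ∞ := ENNReal.mul_ne_top ENNReal.ofReal_ne_top hKT
  have hA₂T : A₂ ≠ ∞ := ENNReal.mul_ne_top ENNReal.ofReal_ne_top ENNReal.ofReal_ne_top
  have hC₀T : C₀ ≠ ∞ :=
    ENNReal.mul_ne_top h2T (ENNReal.add_ne_top.2 ⟨ENNReal.mul_ne_top hDT hA₂T,
      ENNReal.mul_ne_top h2T (ENNReal.add_ne_top.2 ⟨ENNReal.mul_ne_top hDT hA₁T,
        ENNReal.ofReal_ne_top⟩)⟩)
  refine ⟨K * K ^ p * C₀, ENNReal.mul_ne_top (ENNReal.mul_ne_top hKT hKpT) hC₀T, ?_⟩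
  intro n w₀ hw hdy μ hμ _ H1 H2 f
  obtain ⟨v₀, hv₀m, hv₀⟩ := exists_weight w₀ β hβ hw hdy
  have hv0 : ∀ x : EuclideanSpace ℝ (Fin n), 0 < v₀ ‖x‖ := by
    intro x
    have h1 := (hv₀ ‖x‖ (norm_nonneg x)).2
    have h2 := hw ‖x‖ (norm_nonneg x)
    exact pos_of_mul_pos_right (h2.trans_le h1) (by positivity)
  have hvm : Measurable fun x : EuclideanSpace ℝ (Fin n) => v₀ ‖x‖ := hv₀m.comp measurable_norm
  have hle : ∀ x : EuclideanSpace ℝ (Fin n),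
      ENNReal.ofReal (v₀ ‖x‖) ≤ ENNReal.ofReal (w₀ ‖x‖) := fun x =>
    ENNReal.ofReal_le_ofReal (hv₀ ‖x‖ (norm_nonneg x)).1
  have hge : ∀ x : EuclideanSpace ℝ (Fin n),
      ENNReal.ofReal (w₀ ‖x‖) ≤ K * ENNReal.ofReal (v₀ ‖x‖) := fun x => by
    rw [hK, ← ENNReal.ofReal_mul (by positivity)]
    exact ENNReal.ofReal_le_ofReal (hv₀ ‖x‖ (norm_nonneg x)).2
  have hle' : ∀ x : EuclideanSpace ℝ (Fin n),
      ENNReal.ofReal (w₀ ‖x‖ ^ (1 - p)) ≤ ENNReal.ofReal (v₀ ‖x‖ ^ (1 - p)) := fun x =>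
    ENNReal.ofReal_le_ofReal (Real.rpow_le_rpow_of_nonpos (hv0 x)
      (hv₀ ‖x‖ (norm_nonneg x)).1 (by linarith))
  have hge' : ∀ x : EuclideanSpace ℝ (Fin n), ENNReal.ofReal (v₀ ‖x‖ ^ (1 - p)) ≤
      ENNReal.ofReal ((β ^ 2) ^ (p - 1)) * ENNReal.ofReal (w₀ ‖x‖ ^ (1 - p)) := fun x => by
    rw [← ENNReal.ofReal_mul (by positivity)]
    refine ENNReal.ofReal_le_ofReal ?_
    have h1 : (β ^ 2 * v₀ ‖x‖) ^ (1 - p) ≤ w₀ ‖x‖ ^ (1 - p) :=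
      Real.rpow_le_rpow_of_nonpos (hw _ (norm_nonneg x)) (hv₀ ‖x‖ (norm_nonneg x)).2 (by linarith)
    rw [Real.mul_rpow (by positivity) (hv0 x).le] at h1
    calc v₀ ‖x‖ ^ (1 - p)
        = (β ^ 2) ^ (p - 1) * ((β ^ 2) ^ (1 - p) * v₀ ‖x‖ ^ (1 - p)) := by
          rw [← mul_assoc, ← Real.rpow_add (by positivity)]; simp
      _ ≤ _ := by gcongr
  set ν : Measure (EuclideanSpace ℝ (Fin n)) :=
    volume.withDensity (fun x => ENNReal.ofReal (v₀ ‖x‖)) with hν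
  have hνμ : ν ≤ μ := by
    rw [hμ, hν]; exact withDensity_mono (Filter.Eventually.of_forall hle)
  have hμν : μ ≤ K • ν := by
    rw [hμ, hν, ← withDensity_smul _ hvm.ennreal_ofReal]
    exact withDensity_mono (Filter.Eventually.of_forall hge)
  have hsf : SigmaFinite ν :=
    SigmaFinite.withDensity_of_ne_top' (fun x => ENNReal.ofReal_ne_top)
  have hcore : ∀ g : EuclideanSpace ℝ (Fin n) → ℝ,
      ∫⁻ x, centeredMax n ν g x ^ p ∂ν ≤ C₀ * ∫⁻ x, (‖g x‖₊ : ℝ≥0∞) ^ p ∂ν := by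
    refine core_all n p hp ν C₀ ?_
    refine core_meas p L hp hL A₁ A₂ n (fun x => v₀ ‖x‖) hvm hv0 ?_ ?_ ?_
    · intro x y hx hxy hyx
      have h1 := weight_chain w₀ β hβ hdy ‖x‖ ‖y‖ hx hxy hyx
      calc v₀ ‖x‖ ≤ w₀ ‖x‖ := (hv₀ ‖x‖ (norm_nonneg x)).1
        _ ≤ β ^ 3 * w₀ ‖y‖ := h1
        _ ≤ β ^ 3 * (β ^ 2 * v₀ ‖y‖) := by
          gcongr
          exact (hv₀ ‖y‖ (norm_nonneg y)).2
        _ = L * v₀ ‖y‖ := by rw [hLdef]; ring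
    · intro g
      calc _ ≤ ∫⁻ x, centeredMax n volume g x ^ p * ENNReal.ofReal (w₀ ‖x‖) :=
            lintegral_mono fun x => mul_le_mul_right (hle x) _
        _ ≤ _ := H1 g
        _ ≤ ENNReal.ofReal (W₁ ^ p) *
            ∫⁻ x, K * ((‖g x‖₊ : ℝ≥0∞) ^ p * ENNReal.ofReal (v₀ ‖x‖)) := by
            refine mul_le_mul_right (lintegral_mono fun x => ?_) _
            rw [mul_left_comm]
            exact mul_le_mul_right (hge x) _
        _ = _ := by rw [lintegral_const_mul' _ _ hKT, hA₁, mul_assoc]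
    · intro g
      calc _ ≤ ∫⁻ x, ENNReal.ofReal ((β ^ 2) ^ (p - 1)) *
              (centeredMax n volume g x ^ p * ENNReal.ofReal (w₀ ‖x‖ ^ (1 - p))) := by
            refine lintegral_mono fun x => ?_
            rw [mul_left_comm]
            exact mul_le_mul_right (hge' x) _
        _ = ENNReal.ofReal ((β ^ 2) ^ (p - 1)) * ∫⁻ x,
              centeredMax n volume g x ^ p * ENNReal.ofReal (w₀ ‖x‖ ^ (1 - p)) :=
            lintegral_const_mul' _ _ ENNReal.ofReal_ne_top
        _ ≤ ENNReal.ofReal ((β ^ 2) ^ (p - 1)) * _ := mul_le_mul_right (H2 g) _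
        _ ≤ ENNReal.ofReal ((β ^ 2) ^ (p - 1)) * (ENNReal.ofReal (W₂ ^ p) *
            ∫⁻ x, (‖g x‖₊ : ℝ≥0∞) ^ p * ENNReal.ofReal (v₀ ‖x‖ ^ (1 - p))) := by
            refine mul_le_mul_right (mul_le_mul_right (lintegral_mono fun x => ?_) _) _
            exact mul_le_mul_right (hle' x) _
        _ = _ := by rw [hA₂, mul_assoc]
  have hmax : ∀ x, centeredMax n μ f x ≤ K * centeredMax n ν f x := by
    intro x
    refine iSup₂_le fun r hr => ?_
    calc (μ (ball x r))⁻¹ * ∫⁻ y in ball x r, (‖f y‖₊ : ℝ≥0∞) ∂μ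
        ≤ (ν (ball x r))⁻¹ * (K * ∫⁻ y in ball x r, (‖f y‖₊ : ℝ≥0∞) ∂ν) := by
          refine mul_le_mul' (ENNReal.inv_le_inv.2 (hνμ _)) ?_
          calc _ ≤ ∫⁻ y in ball x r, (‖f y‖₊ : ℝ≥0∞) ∂(K • ν) :=
                lintegral_mono' (Measure.restrict_mono subset_rfl hμν) le_rfl
            _ = _ := by rw [Measure.restrict_smul, lintegral_smul_measure, smul_eq_mul]
      _ = K * ((ν (ball x r))⁻¹ * ∫⁻ y in ball x r, (‖f y‖₊ : ℝ≥0∞) ∂ν) := by ring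
      _ ≤ _ := by
          refine mul_le_mul_right ?_ _
          exact le_iSup₂_of_le (f := fun (r : ℝ) (_ : 0 < r) => (ν (ball x r))⁻¹ *
            ∫⁻ y in ball x r, (‖f y‖₊ : ℝ≥0∞) ∂ν) r hr le_rfl
  calc ∫⁻ x, centeredMax n μ f x ^ p ∂μ
      ≤ ∫⁻ x, K ^ p * centeredMax n ν f x ^ p ∂(K • ν) := by
        refine lintegral_mono' hμν fun x => ?_
        rw [← ENNReal.mul_rpow_of_nonneg _ _ hp0]
        exact ENNReal.rpow_le_rpow (hmax x) hp0
    _ = K * K ^ p * ∫⁻ x, centeredMax n ν f x ^ p ∂ν := by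
        rw [lintegral_smul_measure, lintegral_const_mul' _ _ hKpT, smul_eq_mul, mul_assoc]
    _ ≤ K * K ^ p * (C₀ * ∫⁻ x, (‖f x‖₊ : ℝ≥0∞) ^ p ∂ν) := mul_le_mul_right (hcore f) _
    _ ≤ K * K ^ p * (C₀ * ∫⁻ x, (‖f x‖₊ : ℝ≥0∞) ^ p ∂μ) :=
        mul_le_mul_right (mul_le_mul_right (lintegral_mono' hνμ le_rfl) _) _
    _ = _ := by simp only [mul_assoc]
end

section
/- Let μ be a rotation-invariant absolutely continuous measure on ℝⁿ that is weakly doubling with constant K₁, let f be a radial function and suppose that for every ball B(x,R) there is a set D satisfying the conclusions of the projection lemma (B(x,R) ⊂ D, D is radially convex along rays with |x|θ ∈ D̄ for each projected direction θ, and μ(D) ≤ (1+K₁) μ(B(x,R))). Then M_μ f(x) ≤ (1+K₁) M̃_v f₀(|x|), where f(x) = f₀(|x|), v(t) = w₀(t) t^{n−1}, and M̃_v is the one-dimensional non-centered weighted maximal operator. Consequently μ({M_μ f > λ}) ≤ (2(K₁+1)/λ) ‖f‖_{L¹(μ)}. -/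
open MeasureTheory Metric
open scoped ENNReal

/-- The one-dimensional non-centered maximal operator with weight `v(t) = w₀(t) t^(n-1)`. -/
noncomputable def oneDimMax (w₀ : ℝ → ℝ) (n : ℕ) (F : ℝ → ℝ) (r : ℝ) : ℝ≥0∞ :=
  ⨆ (a : ℝ) (b : ℝ) (_ : a ≤ r ∧ r ≤ b),
    (∫⁻ t in Set.Icc a b, ENNReal.ofReal (w₀ t * t ^ (n - 1)))⁻¹ *
      ∫⁻ t in Set.Icc a b, (‖F t‖₊ : ℝ≥0∞) * ENNReal.ofReal (w₀ t * t ^ (n - 1))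


lemma finset_intervals_cover (S : Finset (ℝ × ℝ)) :
    ∃ T ⊆ S, (⋃ i ∈ S, Set.Icc i.1 i.2) ⊆ (⋃ i ∈ T, Set.Icc i.1 i.2) ∧
      ∀ p : ℝ, (T.filter (fun i => p ∈ Set.Icc i.1 i.2)).card ≤ 2 := by
  induction S using Finset.strongInduction with
  | H S ih =>
  by_cases h : ∀ p : ℝ, (S.filter (fun i => p ∈ Set.Icc i.1 i.2)).card ≤ 2
  · exact ⟨S, subset_rfl, subset_rfl, h⟩
  push Not at h
  obtain ⟨p, hp⟩ := h
  set F := S.filter (fun i => p ∈ Set.Icc i.1 i.2) with hF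
  have hne : F.Nonempty := Finset.card_pos.1 (by omega)
  obtain ⟨i, hi, hi'⟩ := F.exists_min_image (fun i => i.1) hne
  obtain ⟨j, hj, hj'⟩ := F.exists_max_image (fun i => i.2) hne
  obtain ⟨k, hk, hk'⟩ : ∃ k ∈ F, k ∉ ({i, j} : Finset (ℝ × ℝ)) := by
    apply Finset.exists_mem_notMem_of_card_lt_card
    exact lt_of_le_of_lt Finset.card_le_two hp
  simp only [Finset.mem_insert, Finset.mem_singleton, not_or] at hk'
  have hkS : k ∈ S := (Finset.mem_filter.1 hk).1
  obtain ⟨T, hT, hc, hm⟩ := ih (S.erase k) (Finset.erase_ssubset hkS)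
  refine ⟨T, hT.trans (Finset.erase_subset _ _), subset_trans ?_ hc, hm⟩
  intro x hx
  simp only [Set.mem_iUnion] at hx ⊢
  obtain ⟨l, hl, hx⟩ := hx
  have hi2 := Finset.mem_filter.1 hi
  have hj2 := Finset.mem_filter.1 hj
  by_cases hlk : l = k
  · subst hlk
    rcases le_total x p with hxp | hxp
    · exact ⟨i, Finset.mem_erase.2 ⟨Ne.symm hk'.1, hi2.1⟩, (hi' l hk).trans hx.1, hxp.trans hi2.2.2⟩
    · exact ⟨j, Finset.mem_erase.2 ⟨Ne.symm hk'.2, hj2.1⟩, hj2.2.1.trans hxp, hx.2.trans (hj' l hk)⟩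
  · exact ⟨l, Finset.mem_erase.2 ⟨hlk, hl⟩, hx⟩

lemma finset_weak (ρ : Measure ℝ) (F : ℝ → ℝ≥0∞) (hF : Measurable F) (c : ℝ≥0∞)
    (S : Finset (ℝ × ℝ))
    (hS : ∀ i ∈ S, c * ρ (Set.Icc i.1 i.2) ≤ ∫⁻ t in Set.Icc i.1 i.2, F t ∂ρ) :
    c * ρ (⋃ i ∈ S, Set.Icc i.1 i.2) ≤ 2 * ∫⁻ t, F t ∂ρ := by
  obtain ⟨T, hT, hc, hm⟩ := finset_intervals_cover S
  calc c * ρ (⋃ i ∈ S, Set.Icc i.1 i.2) ≤ c * ∑ i ∈ T, ρ (Set.Icc i.1 i.2) := by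
        gcongr
        exact (measure_mono hc).trans (measure_biUnion_finset_le _ _)
    _ = ∑ i ∈ T, c * ρ (Set.Icc i.1 i.2) := by rw [Finset.mul_sum]
    _ ≤ ∑ i ∈ T, ∫⁻ t in Set.Icc i.1 i.2, F t ∂ρ := Finset.sum_le_sum fun i hi => hS i (hT hi)
    _ = ∑ i ∈ T, ∫⁻ t, (Set.Icc i.1 i.2).indicator F t ∂ρ := by
        simp_rw [lintegral_indicator measurableSet_Icc]
    _ = ∫⁻ t, ∑ i ∈ T, (Set.Icc i.1 i.2).indicator F t ∂ρ := by
        rw [lintegral_finsetSum]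
        intro i _
        exact hF.indicator measurableSet_Icc
    _ ≤ ∫⁻ t, 2 * F t ∂ρ := by
        apply lintegral_mono
        intro t
        simp only [Set.indicator_apply]
        rw [← Finset.sum_filter, Finset.sum_const, nsmul_eq_mul]
        gcongr
        exact_mod_cast hm t
    _ = 2 * ∫⁻ t, F t ∂ρ := lintegral_const_mul _ hF

lemma weak_union (ρ : Measure ℝ) (hρ : ρ ≪ volume) (F : ℝ → ℝ≥0∞) (hF : Measurable F) (c : ℝ≥0∞)
    (I : Set (ℝ × ℝ)) (hlt : ∀ i ∈ I, i.1 < i.2)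
    (hS : ∀ i ∈ I, c * ρ (Set.Icc i.1 i.2) ≤ ∫⁻ t in Set.Icc i.1 i.2, F t ∂ρ) :
    c * ρ (⋃ i ∈ I, Set.Icc i.1 i.2) ≤ 2 * ∫⁻ t, F t ∂ρ := by
  obtain ⟨T, hTI, hTc, hTU⟩ := TopologicalSpace.isOpen_biUnion_countable I
    (fun i => Set.Ioo i.1 i.2) (fun i _ => isOpen_Ioo)
  set N : Set ℝ := (⋃ i ∈ I, Set.Icc i.1 i.2) \ (⋃ i ∈ I, Set.Ioo i.1 i.2) with hN
  have hNc : N.Countable := by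
    have h1 := countable_setOfPred_isolated_right_within (s := N)
    have h2 := countable_setOfPred_isolated_left_within (s := N)
    refine (h1.union h2).mono ?_
    rintro x ⟨hx1, hx2⟩
    have hx1' := hx1
    simp only [Set.mem_iUnion] at hx1
    obtain ⟨i, hi, hxi⟩ := hx1
    have hd : ∀ z ∈ N, z ∉ Set.Ioo i.1 i.2 := fun z hz hz' =>
      hz.2 (Set.mem_biUnion hi hz')
    have hxn := hd x ⟨hx1', hx2⟩
    by_cases hxe : x = i.1
    · left
      refine ⟨⟨hx1', hx2⟩, ?_⟩
      rw [← Filter.empty_mem_iff_bot, mem_nhdsWithin]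
      have hl := hlt i hi
      refine ⟨Set.Iio i.2, isOpen_Iio, by rw [Set.mem_Iio, hxe]; exact hl, ?_⟩
      rintro z ⟨hz, hzN, hzx⟩
      have hzx' := Set.mem_Ioi.1 hzx
      rw [hxe] at hzx'
      exact hd z hzN ⟨hzx', hz⟩
    · right
      have hxe2 : x = i.2 := by
        by_contra h
        exact hxn ⟨lt_of_le_of_ne hxi.1 (Ne.symm hxe), lt_of_le_of_ne hxi.2 h⟩
      refine ⟨⟨hx1', hx2⟩, ?_⟩
      rw [← Filter.empty_mem_iff_bot, mem_nhdsWithin]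
      have hl := hlt i hi
      refine ⟨Set.Ioi i.1, isOpen_Ioi, by rw [Set.mem_Ioi, hxe2]; exact hl, ?_⟩
      rintro z ⟨hz, hzN, hzx⟩
      have hzx' := Set.mem_Iio.1 hzx
      rw [hxe2] at hzx'
      exact hd z hzN ⟨hz, hzx'⟩
  have hN0 : ρ N = 0 := hρ (hNc.measure_zero volume)
  have hle : ρ (⋃ i ∈ I, Set.Icc i.1 i.2) ≤ ρ (⋃ i ∈ T, Set.Icc i.1 i.2) := by
    calc ρ (⋃ i ∈ I, Set.Icc i.1 i.2) ≤ ρ ((⋃ i ∈ T, Set.Icc i.1 i.2) ∪ N) := by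
          apply measure_mono
          intro x hx
          by_cases hx' : x ∈ ⋃ i ∈ I, Set.Ioo i.1 i.2
          · left
            rw [← hTU] at hx'
            exact Set.iUnion₂_mono (fun i _ => Set.Ioo_subset_Icc_self) hx'
          · exact Or.inr ⟨hx, hx'⟩
      _ ≤ _ := (measure_union_le _ _).trans (by rw [hN0, add_zero])
  refine (mul_le_mul_right hle c).trans ?_
  rcases T.eq_empty_or_nonempty with hT | hT
  · simp [hT]
  obtain ⟨u, hu⟩ := hTc.exists_eq_range hT
  rw [hu, Set.biUnion_range, measure_iUnion_eq_iSup_accumulate, ENNReal.mul_iSup]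
  refine iSup_le fun m => ?_
  have := finset_weak ρ F hF c ((Finset.range (m+1)).image u) (by
    intro i hi
    obtain ⟨k, _, rfl⟩ := Finset.mem_image.1 hi
    exact hS _ (hTI (hu ▸ Set.mem_range_self k)))
  refine le_trans (mul_le_mul_right (measure_mono ?_) c) this
  intro x hx
  rw [Set.mem_accumulate] at hx
  obtain ⟨k, hk, hx⟩ := hx
  exact Set.mem_biUnion (Finset.mem_coe.2 (Finset.mem_image_of_mem u (Finset.mem_range.2 (by omega)))) hx

/-- auxiliary noncentered maximal function wrt a measure on the half line -/
noncomputable def auxMax (ρ : Measure ℝ) (F : ℝ → ℝ≥0∞) (r : ℝ) : ℝ≥0∞ :=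
  ⨆ (a : ℝ) (b : ℝ) (_ : a ≤ r ∧ r ≤ b),
    (ρ (Set.Icc a b))⁻¹ * ∫⁻ t in Set.Icc a b, F t ∂ρ

lemma auxMax_weak (ρ : Measure ℝ) (hρ : ρ ≪ volume) (F : ℝ → ℝ≥0∞) (hF : Measurable F)
    (c : ℝ≥0∞) : ∃ E : Set ℝ, MeasurableSet E ∧ {r | c < auxMax ρ F r} ⊆ E ∧
      c * ρ E ≤ 2 * ∫⁻ t, F t ∂ρ := by
  set I : Set (ℝ × ℝ) := {i | i.1 < i.2 ∧
    c * ρ (Set.Icc i.1 i.2) ≤ ∫⁻ t in Set.Icc i.1 i.2, F t ∂ρ}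
  have := weak_union ρ hρ F hF c I (fun i hi => hi.1) (fun i hi => hi.2)
  refine ⟨toMeasurable ρ (⋃ i ∈ I, Set.Icc i.1 i.2), measurableSet_toMeasurable _ _,
    subset_trans ?_ (subset_toMeasurable _ _), by rwa [measure_toMeasurable]⟩
  intro r hr
  simp only [Set.mem_ofPred_eq, auxMax, lt_iSup_iff] at hr
  obtain ⟨a, b, hab, h⟩ := hr
  refine Set.mem_biUnion (x := (a, b)) ⟨?_, ?_⟩ hab
  · refine lt_of_le_of_ne (hab.1.trans hab.2) ?_
    intro hab'
    have hab' : a = b := hab'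
    subst hab'
    have : ρ (Set.Icc a a) = 0 := hρ (by simp)
    rw [setLIntegral_measure_zero _ _ this] at h
    simp at h
  · show c * ρ (Set.Icc a b) ≤ ∫⁻ t in Set.Icc a b, F t ∂ρ
    refine (mul_le_mul_left h.le _).trans ?_
    rw [mul_comm, ← mul_assoc]
    refine (mul_le_mul_left (ENNReal.mul_inv_le_one _) _).trans (by rw [one_mul])

lemma auxMax_section (ρ : Measure ℝ) (hρ : ρ ≪ volume) (F : ℝ → ℝ≥0∞)
    (J : Set ℝ) (hJb : BddAbove J) (hJa : BddBelow J) (X : ℝ)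
    (h1 : ∀ r ∈ J, ∀ s, r < s → s < X → s ∈ J)
    (h2 : ∀ r ∈ J, ∀ s, X < s → s < r → s ∈ J) (hfin : ρ J ≠ ⊤) :
    ∫⁻ t in J, F t ∂ρ ≤ auxMax ρ F X * ρ J := by
  set J' := insert X J with hJ'
  have hb : BddAbove J' := hJb.insert X
  have ha : BddBelow J' := hJa.insert X
  have hae : J =ᵐ[ρ] Set.Icc (sInf J') (sSup J') := by
    apply hρ.ae_eq
    have hsub : J ⊆ Set.Icc (sInf J') (sSup J') := fun r hr =>
      ⟨csInf_le ha (Or.inr hr), le_csSup hb (Or.inr hr)⟩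
    refine Filter.EventuallyLE.antisymm (LE.le.eventuallyLE hsub) ?_
    rw [ae_le_set]
    refine measure_mono_null (t := {sInf J', sSup J', X}) ?_
      ((Set.toFinite _).measure_zero _)
    rintro r ⟨⟨hr1, hr2⟩, hrJ⟩
    by_contra hne
    simp only [Set.mem_insert_iff, Set.mem_singleton_iff, not_or] at hne
    obtain ⟨hn1, hn2, hn3⟩ := hne
    have hr1 := lt_of_le_of_ne hr1 (Ne.symm hn1)
    have hr2 := lt_of_le_of_ne hr2 hn2
    rcases lt_or_gt_of_ne hn3 with hX | hX
    · obtain ⟨s, hs, hsr⟩ := exists_lt_of_csInf_lt (Set.insert_nonempty _ _) hr1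
      rcases hs with rfl | hs
      · linarith
      · exact hrJ (h1 s hs r hsr hX)
    · obtain ⟨s, hs, hsr⟩ := exists_lt_of_lt_csSup (Set.insert_nonempty _ _) hr2
      rcases hs with rfl | hs
      · linarith
      · exact hrJ (h2 s hs r hX hsr)
  rw [measure_congr hae, setLIntegral_congr hae]
  rw [measure_congr hae] at hfin
  set a := sInf J'
  set b := sSup J'
  have hX : a ≤ X ∧ X ≤ b := ⟨csInf_le ha (Or.inl rfl), le_csSup hb (Or.inl rfl)⟩
  by_cases h0 : ρ (Set.Icc a b) = 0
  · rw [setLIntegral_measure_zero _ _ h0]; exact zero_le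
  have hle : (ρ (Set.Icc a b))⁻¹ * ∫⁻ t in Set.Icc a b, F t ∂ρ ≤ auxMax ρ F X :=
    le_iSup_of_le a (le_iSup_of_le b (le_iSup_of_le hX le_rfl))
  refine le_trans (le_of_eq ?_) (mul_le_mul_left hle _)
  rw [mul_comm, ← mul_assoc, ENNReal.mul_inv_cancel h0 hfin, one_mul]

section geo
variable {E : Type*} [NormedAddCommGroup E] [InnerProductSpace ℝ E]

lemma mem_ball_iff_quad (x y : E) (R : ℝ) (hR : 0 < R) :
    y ∈ ball x R ↔ ‖y‖ ^ 2 - 2 * inner ℝ y x + ‖x‖ ^ 2 < R ^ 2 := by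
  rw [mem_ball, dist_eq_norm, ← norm_sub_sq_real, sq_lt_sq₀ (norm_nonneg _) hR.le]

lemma mem_ball_smul_iff_quad (x y : E) (s R : ℝ) (hR : 0 < R) :
    s • y ∈ ball x R ↔ s ^ 2 * ‖y‖ ^ 2 - 2 * s * inner ℝ y x + ‖x‖ ^ 2 < R ^ 2 := by
  rw [mem_ball_iff_quad _ _ _ hR, norm_smul, real_inner_smul_left, mul_pow, Real.norm_eq_abs, sq_abs,
    mul_assoc]

lemma geo_outer (x y : E) (R s : ℝ) (hR : 0 < R) (hs : 1 ≤ s) (hxy : ‖x‖ ≤ ‖y‖)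
    (h : s • y ∈ ball x R) : y ∈ ball x R := by
  rw [mem_ball_smul_iff_quad _ _ _ _ hR] at h
  rw [mem_ball_iff_quad _ _ _ hR]
  have hp : inner ℝ y x ≤ ‖y‖ * ‖x‖ := real_inner_le_norm _ _
  have hp2 : inner ℝ y x ≤ ‖y‖ ^ 2 := by nlinarith [norm_nonneg y]
  have h2 : 0 ≤ (s - 1) * ((s + 1) * ‖y‖ ^ 2 - 2 * inner ℝ y x) := by
    apply mul_nonneg (by linarith)
    nlinarith [sq_nonneg ‖y‖]
  nlinarith

lemma geo_inner (x y : E) (R s : ℝ) (hR : 0 < R) (hRx : R ≤ ‖x‖) (hs0 : 0 < s) (hs : s < 1)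
    (hxy : ‖y‖ < ‖x‖) (h : s • y ∈ ball x R) (hy : y ∉ ball x R) :
    y ∈ ball ((√(‖x‖ ^ 2 - R ^ 2) / ‖x‖) • x) R := by
  rw [mem_ball_smul_iff_quad _ _ _ _ hR] at h
  rw [mem_ball_iff_quad _ _ _ hR, not_lt] at hy
  rw [mem_ball_iff_quad _ _ _ hR, norm_smul, real_inner_smul_right, mul_pow, Real.norm_eq_abs, sq_abs]
  have hX : 0 < ‖x‖ := by linarith
  have hT2 : √(‖x‖ ^ 2 - R ^ 2) ^ 2 = ‖x‖ ^ 2 - R ^ 2 := Real.sq_sqrt (by nlinarith)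
  have hT0 := Real.sqrt_nonneg (‖x‖ ^ 2 - R ^ 2)
  have hY := norm_nonneg y
  generalize √(‖x‖ ^ 2 - R ^ 2) = T at *
  generalize ‖x‖ = X at *
  generalize ‖y‖ = Y at *
  generalize (inner ℝ y x : ℝ) = p at *
  have hTX : T < X := by nlinarith
  have hp : Y * T < p := by
    have h1 : 0 ≤ (s * Y - T) ^ 2 := sq_nonneg _
    have h2 : 0 < 2 * s * (p - Y * T) := by nlinarith
    have := (mul_pos_iff_of_pos_left (by positivity : 0 < 2 * s)).1 h2
    linarith
  have hYT : T < Y := by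
    have h1 : 0 < (1 - s) * (s * Y ^ 2 - T ^ 2) := by nlinarith
    have h2 := (mul_pos_iff_of_pos_left (by linarith : 0 < 1 - s)).1 h1
    have : T ^ 2 < Y ^ 2 := by nlinarith [sq_nonneg Y]
    exact lt_of_pow_lt_pow_left₀ 2 hY this
  have e1 : (T / X) ^ 2 * X ^ 2 = T ^ 2 := by field_simp
  rw [e1]
  have h3 : T / X * (Y * T) ≤ T / X * p := by gcongr
  have h4 : Y ^ 2 + 2 * T ^ 2 - X ^ 2 < 2 * (T / X * (Y * T)) := by
    have e2 : 2 * (T / X * (Y * T)) - (Y ^ 2 + 2 * T ^ 2 - X ^ 2) =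
      (X - Y) * (X * (X + Y) - 2 * T ^ 2) / X := by field_simp; ring
    have : 0 < (X - Y) * (X * (X + Y) - 2 * T ^ 2) / X := by
      apply div_pos (mul_pos (by linarith) _) hX
      nlinarith
    linarith
  nlinarith

/-- the center of the ball covering the added part -/
lemma geo_center (x : E) (R : ℝ) (hR : 0 < R) : ∃ c : E, (ball x R ∩ ball c R).Nonempty ∧
    ∀ y : E, ∀ s : ℝ, 0 < s → s < 1 → ‖y‖ < ‖x‖ → s • y ∈ ball x R → y ∉ ball x R →
      y ∈ ball c R := by
  rcases le_total R ‖x‖ with h | h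
  · refine ⟨_, ?_, fun y s hs0 hs hxy h1 h2 => geo_inner x y R s hR h hs0 hs hxy h1 h2⟩
    have hX : 0 < ‖x‖ := by linarith
    have hT2 : √(‖x‖ ^ 2 - R ^ 2) ^ 2 = ‖x‖ ^ 2 - R ^ 2 := Real.sq_sqrt (by nlinarith)
    have hT0 := Real.sqrt_nonneg (‖x‖ ^ 2 - R ^ 2)
    set T := √(‖x‖ ^ 2 - R ^ 2)
    have hTX : T < ‖x‖ := by nlinarith
    refine ⟨((1 + T / ‖x‖) / 2) • x, ?_, ?_⟩
    · have e : ((1 + T / ‖x‖) / 2) • x - x = (- ((‖x‖ - T) / (2 * ‖x‖))) • x := by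
        nth_rw 3 [← one_smul ℝ x]
        rw [← sub_smul]; congr 1; field_simp; ring
      rw [mem_ball, dist_eq_norm, e, norm_smul, norm_neg, Real.norm_of_nonneg (by
        apply div_nonneg <;> linarith)]
      have : (‖x‖ - T) / (2 * ‖x‖) * ‖x‖ = (‖x‖ - T) / 2 := by field_simp
      rw [this]; nlinarith
    · have e : ((1 + T / ‖x‖) / 2) • x - (T / ‖x‖) • x = ((‖x‖ - T) / (2 * ‖x‖)) • x := by
        rw [← sub_smul]; congr 1; field_simp; ring
      rw [mem_ball, dist_eq_norm, e, norm_smul, Real.norm_of_nonneg (by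
        apply div_nonneg <;> linarith)]
      have : (‖x‖ - T) / (2 * ‖x‖) * ‖x‖ = (‖x‖ - T) / 2 := by field_simp
      rw [this]; nlinarith
  · refine ⟨0, ⟨(1/2 : ℝ) • x, ?_, ?_⟩, fun y s _ _ hxy _ _ => by
      rw [mem_ball_zero_iff]; linarith⟩
    · have e : (1/2 : ℝ) • x - x = (-(1/2 : ℝ)) • x := by
        nth_rw 2 [← one_smul ℝ x]
        rw [← sub_smul]; norm_num
      rw [mem_ball, dist_eq_norm, e, norm_smul]
      norm_num; linarith
    · rw [mem_ball_zero_iff, norm_smul]; norm_num; linarith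

/-- the projection set -/
def projD (x : E) (R : ℝ) : Set E :=
  ball x R ∪ ((⋃ s ∈ Set.Ioo (0:ℝ) 1, (fun y : E => s • y) ⁻¹' ball x R) ∩ ball 0 ‖x‖)

lemma projD_isOpen (x : E) (R : ℝ) : IsOpen (projD x R) := by
  refine isOpen_ball.union (IsOpen.inter ?_ isOpen_ball)
  exact isOpen_biUnion fun s _ => isOpen_ball.preimage (continuous_const_smul s)

lemma projD_measure [MeasurableSpace E] (μ : Measure E) (x : E) (R : ℝ) (hR : 0 < R) (K : ℝ≥0∞)
    (hwd : ∀ y : E, (ball x R ∩ ball y R).Nonempty → μ (ball y R) ≤ K * μ (ball x R)) :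
    μ (projD x R) ≤ (1 + K) * μ (ball x R) := by
  obtain ⟨c, hc, hsub⟩ := geo_center x R hR
  have : projD x R ⊆ ball x R ∪ ball c R := by
    rintro y (hy | ⟨hy, hyx⟩)
    · exact Or.inl hy
    · by_cases h : y ∈ ball x R
      · exact Or.inl h
      · simp only [Set.mem_iUnion] at hy
        obtain ⟨s, hs, hy⟩ := hy
        exact Or.inr (hsub y s hs.1 hs.2 (mem_ball_zero_iff.1 hyx) hy h)
  refine (measure_mono this).trans ((measure_union_le _ _).trans ?_)
  rw [add_mul, one_mul]
  gcongr
  exact hwd c hc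

lemma projD_section_inner (x θ : E) (hθ : ‖θ‖ = 1) (R : ℝ) (r s : ℝ) (hr : 0 < r)
    (h : r • θ ∈ projD x R) (hrs : r < s) (hs : s < ‖x‖) : s • θ ∈ projD x R := by
  have hs0 : 0 < s := hr.trans hrs
  have hrs1 : r / s < 1 := (div_lt_one hs0).2 hrs
  have hrs0 : 0 < r / s := div_pos hr hs0
  refine Or.inr ⟨?_, by rw [mem_ball_zero_iff, norm_smul, hθ, Real.norm_of_nonneg hs0.le, mul_one]; exact hs⟩
  have e : (r / s) • s • θ = r • θ := by rw [smul_smul]; congr 1; field_simp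
  simp only [Set.mem_iUnion]
  rcases h with h | ⟨h, _⟩
  · exact ⟨r / s, ⟨hrs0, hrs1⟩, by rw [Set.mem_preimage, e]; exact h⟩
  · simp only [Set.mem_iUnion] at h
    obtain ⟨t, ht, h⟩ := h
    refine ⟨t * (r / s), ⟨mul_pos ht.1 hrs0, by nlinarith [ht.1, ht.2]⟩, ?_⟩
    rw [Set.mem_preimage, mul_smul, e]; exact h

lemma projD_section_outer (x θ : E) (hθ : ‖θ‖ = 1) (R : ℝ) (hR : 0 < R) (r s : ℝ)
    (h : r • θ ∈ projD x R) (hrs : s < r) (hs : ‖x‖ < s) : s • θ ∈ projD x R := by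
  have hs0 : 0 < s := (norm_nonneg x).trans_lt hs
  have e : (r / s) • s • θ = r • θ := by rw [smul_smul]; congr 1; field_simp
  have hn : ∀ t : ℝ, 0 < t → ‖t • θ‖ = t := fun t ht => by
    rw [norm_smul, hθ, Real.norm_of_nonneg ht.le, mul_one]
  left
  rcases h with h | ⟨_, h⟩
  · refine geo_outer x _ R (r / s) hR ((one_le_div hs0).2 hrs.le) (by rw [hn s hs0]; exact hs.le) ?_
    rw [e]; exact h
  · rw [mem_ball_zero_iff, hn r (hs0.trans hrs)] at h
    linarith

lemma projD_bdd (x θ : E) (hθ : ‖θ‖ = 1) (R : ℝ) (hR : 0 < R) (r : ℝ) (hr : 0 < r)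
    (h : r • θ ∈ projD x R) : r ≤ ‖x‖ + R := by
  have hn : ‖r • θ‖ = r := by
    rw [norm_smul, hθ, Real.norm_of_nonneg hr.le, mul_one]
  rcases h with h | ⟨_, h⟩
  · have := norm_lt_of_mem_ball h
    linarith
  · rw [mem_ball_zero_iff] at h
    linarith
end geo
section polar
variable {E : Type*} [NormedAddCommGroup E] [NormedSpace ℝ E] [MeasurableSpace E] [BorelSpace E]

def IsPolar (σ : Measure (sphere (0 : E) 1)) (m : Measure E) (ρ : Measure ℝ) : Prop :=
  ∀ g : E → ℝ≥0∞, Measurable g →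
    ∫⁻ x, g x ∂m = ∫⁻ θ, ∫⁻ r, g (r • (θ : E)) ∂ρ ∂σ

noncomputable def radial (k : ℕ) : Measure ℝ :=
  (volume.restrict (Set.Ioi (0 : ℝ))).withDensity fun r => ENNReal.ofReal (r ^ k)

lemma isPolar_volume [FiniteDimensional ℝ E] [Nontrivial E] (m : Measure E) [m.IsAddHaarMeasure] :
    IsPolar m.toSphere m (radial (Module.finrank ℝ E - 1)) := by
  intro g hg
  have h1 : ∫⁻ x, g x ∂m = ∫⁻ x : ({(0)}ᶜ : Set E), g x ∂(m.comap (↑)) := by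
    rw [lintegral_subtype_comap (measurableSet_singleton _).compl, restrict_compl_singleton]
  have hmp := m.measurePreserving_homeomorphUnitSphereProd
  have h2 : ∫⁻ x : ({(0)}ᶜ : Set E), g x ∂(m.comap (↑)) =
      ∫⁻ p, g ((homeomorphUnitSphereProd E).symm p) ∂(m.toSphere.prod
        (Measure.volumeIoiPow (Module.finrank ℝ E - 1))) := by
    rw [← hmp.lintegral_comp_emb (Homeomorph.measurableEmbedding _)]
    simp
  rw [h1, h2, lintegral_prod]
  · refine lintegral_congr fun θ => ?_
    rw [Measure.volumeIoiPow, radial, lintegral_withDensity_eq_lintegral_mul,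
      lintegral_withDensity_eq_lintegral_mul]
    · simp only [Pi.mul_apply, homeomorphUnitSphereProd_symm_apply_coe]
      rw [lintegral_subtype_comap (μ := volume) (s := Set.Ioi (0:ℝ)) measurableSet_Ioi (fun r => ENNReal.ofReal (r ^ (Module.finrank ℝ E - 1)) * g (r • (θ : E)))]
    · fun_prop
    · exact hg.comp (by fun_prop)
    · fun_prop
    · refine hg.comp ?_
      exact measurable_subtype_coe.comp ((homeomorphUnitSphereProd E).symm.measurable.comp (by fun_prop))
  · refine Measurable.aemeasurable (hg.comp ?_)
    exact measurable_subtype_coe.comp ((homeomorphUnitSphereProd E).symm.measurable)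

lemma isPolar_withDensity {σ : Measure (sphere (0 : E) 1)} {m : Measure E} {ρ : Measure ℝ}
    (h : IsPolar σ m ρ) (hρ : ∀ᵐ r ∂ρ, 0 < r) (w : ℝ → ℝ≥0∞) (hw : Measurable w) :
    IsPolar σ (m.withDensity fun x => w ‖x‖) (ρ.withDensity w) := by
  intro g hg
  have hw' : Measurable fun x : E => w ‖x‖ := hw.comp measurable_norm
  rw [lintegral_withDensity_eq_lintegral_mul _ hw' hg, h]
  · refine lintegral_congr fun θ => ?_
    have hgθ : Measurable fun r : ℝ => g (r • (θ : E)) := hg.comp (by fun_prop)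
    rw [lintegral_withDensity_eq_lintegral_mul _ hw hgθ]
    refine lintegral_congr_ae ?_
    filter_upwards [hρ] with r hr
    have : ‖r • (θ : E)‖ = r := by
      rw [norm_smul, norm_eq_of_mem_sphere, Real.norm_of_nonneg hr.le, mul_one]
    simp [this]
  · exact hw'.mul hg

lemma polar_envelope {σ : Measure (sphere (0 : E) 1)} {m : Measure E} {ρ : Measure ℝ}
    [SFinite m] [SigmaFinite ρ]
    (h : IsPolar σ m ρ) (hρ : ∀ᵐ r ∂ρ, 0 < r) (w : ℝ → ℝ≥0∞) :
    ∃ w₁ : ℝ → ℝ≥0∞, Measurable w₁ ∧ w₁ ≤ w ∧ ρ.withDensity w₁ = ρ.withDensity w ∧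
      (m.withDensity fun x => w₁ ‖x‖) = m.withDensity fun x => w ‖x‖ := by
  obtain ⟨w₁, hm, hle, heq⟩ := exists_measurable_le_withDensity_eq ρ w
  refine ⟨w₁, hm, hle, heq, le_antisymm ?_ ?_⟩
  · exact withDensity_mono (Filter.Eventually.of_forall fun x => hle _)
  obtain ⟨g, hgm, hgle, hgeq⟩ := exists_measurable_le_withDensity_eq m (fun x => w ‖x‖)
  rw [← hgeq, Measure.le_iff]
  intro s hs
  have hm' : Measurable fun x : E => w₁ ‖x‖ := hm.comp measurable_norm
  rw [withDensity_apply _ hs, withDensity_apply _ hs, ← lintegral_indicator hs,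
    ← lintegral_indicator hs, h _ (hgm.indicator hs), h _ (hm'.indicator hs)]
  refine lintegral_mono fun θ => lintegral_mono_ae ?_
  have hn : ∀ r : ℝ, 0 < r → ‖r • (θ : E)‖ = r := fun r hr => by
      rw [norm_smul, norm_eq_of_mem_sphere, Real.norm_of_nonneg hr.le, mul_one]
  have key : (fun r : ℝ => g (r • (θ : E))) ≤ᵐ[ρ] w₁ := by
    refine ae_le_of_forall_setLIntegral_le_of_sigmaFinite (hgm.comp (by fun_prop)) ?_
    intro t ht _
    rw [← withDensity_apply w₁ ht, heq, withDensity_apply _ ht]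
    refine lintegral_mono_ae (ae_restrict_of_ae ?_)
    filter_upwards [hρ] with r hr
    have := hgle (r • (θ : E))
    simpa only [hn r hr] using this
  filter_upwards [hρ, key] with r hr hk
  by_cases hrs : r • (θ : E) ∈ s
  · simp only [Set.indicator_of_mem hrs, hn r hr]; exact hk
  · simp [Set.indicator_of_notMem hrs]

lemma radial_pos (k : ℕ) : ∀ᵐ r ∂(radial k), 0 < r :=
  (withDensity_absolutelyContinuous _ _).ae_le (ae_restrict_mem measurableSet_Ioi)

lemma radial_ac (k : ℕ) : radial k ≪ volume :=
  (withDensity_absolutelyContinuous _ _).trans Measure.restrict_le_self.absolutelyContinuous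

instance (k : ℕ) : SigmaFinite (radial k) :=
  SigmaFinite.withDensity_ofReal _
end polar

lemma setLIntegral_radial (k : ℕ) (H : ℝ → ℝ≥0∞) (a b : ℝ) (ha : 0 ≤ a) :
    ∫⁻ t in Set.Icc a b, H t ∂(radial k) =
      ∫⁻ t in Set.Icc a b, ENNReal.ofReal (t ^ k) * H t := by
  rw [radial, setLIntegral_withDensity_eq_setLIntegral_mul_non_measurable _ (by fun_prop) _
    measurableSet_Icc (by simp), Measure.restrict_restrict measurableSet_Icc]
  simp only [Pi.mul_apply]
  apply setLIntegral_congr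
  have h0 : ∀ᵐ t : ℝ, t ≠ 0 := by simp [ae_iff]
  filter_upwards [h0] with t ht
  apply propext
  refine ⟨fun h => h.1, fun h => ⟨h, ?_⟩⟩
  have : a ≤ t := h.1
  exact lt_of_le_of_ne (ha.trans this) (Ne.symm ht)

lemma auxMax_le_oneDimMax (w₀ f₀ : ℝ → ℝ) (n : ℕ) (w₁ F₁ : ℝ → ℝ≥0∞) (hw₁ : Measurable w₁)
    (hF₁ : Measurable F₁)
    (hwle : w₁ ≤ fun t => ENNReal.ofReal (w₀ t)) (hFle : F₁ ≤ fun t => (‖f₀ t‖₊ : ℝ≥0∞))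
    (hweq : (radial (n - 1)).withDensity w₁ =
      (radial (n - 1)).withDensity fun t => ENNReal.ofReal (w₀ t)) (X : ℝ) (hX : 0 ≤ X) :
    auxMax ((radial (n - 1)).withDensity w₁) F₁ X ≤ oneDimMax w₀ n f₀ X := by
  set ρ := (radial (n - 1)).withDensity w₁ with hρ
  have hpos : ∀ᵐ r ∂ρ, 0 < r := (withDensity_absolutelyContinuous _ _).ae_le (radial_pos _)
  refine iSup_le fun a => iSup_le fun b => iSup_le fun hab => ?_
  have hae : Set.Icc a b =ᵐ[ρ] Set.Icc (max a 0) b := by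
    filter_upwards [hpos] with t ht
    apply propext
    exact ⟨fun h => ⟨max_le h.1 ht.le, h.2⟩, fun h => ⟨(le_max_left _ _).trans h.1, h.2⟩⟩
  rw [measure_congr hae, setLIntegral_congr hae]
  refine le_trans ?_ (le_iSup_of_le (max a 0) (le_iSup_of_le b
    (le_iSup_of_le ⟨max_le hab.1 hX, hab.2⟩ le_rfl)))
  have ha0 : 0 ≤ max a 0 := le_max_right _ _
  generalize max a 0 = a' at *
  have e : ∀ t ∈ Set.Icc a' b, ENNReal.ofReal (w₀ t * t ^ (n - 1)) =
      ENNReal.ofReal (t ^ (n - 1)) * ENNReal.ofReal (w₀ t) := by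
    intro t ht
    rw [ENNReal.ofReal_mul' (pow_nonneg (ha0.trans ht.1) _), mul_comm]
  refine mul_le_mul' (le_of_eq ?_) ?_
  · rw [hweq, withDensity_apply _ measurableSet_Icc, setLIntegral_radial _ _ _ _ ha0]
    congr 1
    exact (setLIntegral_congr_fun measurableSet_Icc e).symm
  · rw [hρ, setLIntegral_withDensity_eq_setLIntegral_mul _ hw₁ hF₁ measurableSet_Icc,
      setLIntegral_radial _ _ _ _ ha0]
    refine setLIntegral_mono' measurableSet_Icc fun t ht => ?_
    rw [e t ht, Pi.mul_apply, mul_comm (‖f₀ t‖₊ : ℝ≥0∞), mul_assoc]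
    gcongr
    · exact hwle t
    · exact hFle t

lemma polar_ball_bound {E : Type*} [NormedAddCommGroup E] [InnerProductSpace ℝ E]
    [MeasurableSpace E] [BorelSpace E] [SecondCountableTopology E]
    {σ : Measure (sphere (0 : E) 1)} [SFinite σ] {m : Measure E} {ρ : Measure ℝ} [SFinite ρ]
    (h : IsPolar σ m ρ) (hρ : ∀ᵐ r ∂ρ, 0 < r) (hac : ρ ≪ volume) (F : ℝ → ℝ≥0∞)
    (hF : Measurable F) (x : E) (R : ℝ) (hR : 0 < R) (hfin : m (projD x R) ≠ ⊤) :
    ∫⁻ y in projD x R, F ‖y‖ ∂m ≤ auxMax ρ F ‖x‖ * m (projD x R) := by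
  have hDm : MeasurableSet (projD x R) := (projD_isOpen x R).measurableSet
  set J : sphere (0 : E) 1 → Set ℝ := fun θ => {r | 0 < r ∧ r • (θ : E) ∈ projD x R} with hJ
  have hJm : ∀ θ, MeasurableSet (J θ) := fun θ =>
    measurableSet_Ioi.inter (hDm.preimage (by fun_prop))
  have hFm : Measurable fun y : E => F ‖y‖ := hF.comp measurable_norm
  have hn : ∀ (θ : sphere (0 : E) 1) (r : ℝ), 0 < r → ‖r • (θ : E)‖ = r := fun θ r hr => by
      rw [norm_smul, norm_eq_of_mem_sphere, Real.norm_of_nonneg hr.le, mul_one]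
  have hgen : ∀ G : ℝ → ℝ≥0∞, Measurable G → ∫⁻ y in projD x R, G ‖y‖ ∂m =
      ∫⁻ θ, ∫⁻ r in J θ, G r ∂ρ ∂σ := by
    intro G hG
    have hGm : Measurable fun y : E => G ‖y‖ := hG.comp measurable_norm
    rw [← lintegral_indicator hDm, h _ (hGm.indicator hDm)]
    refine lintegral_congr fun θ => ?_
    rw [← lintegral_indicator (hJm θ)]
    refine lintegral_congr_ae ?_
    filter_upwards [hρ] with r hr
    by_cases hrs : r • (θ : E) ∈ projD x R
    · rw [Set.indicator_of_mem hrs, Set.indicator_of_mem (show r ∈ J θ from ⟨hr, hrs⟩), hn θ r hr]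
    · rw [Set.indicator_of_notMem hrs, Set.indicator_of_notMem (fun h => hrs h.2)]
  have hmeas : m (projD x R) = ∫⁻ θ, ρ (J θ) ∂σ := by
    have := hgen (fun _ => 1) measurable_const
    simpa using this
  have hJmeas : Measurable fun θ => ρ (J θ) := by
    have : MeasurableSet {p : sphere (0 : E) 1 × ℝ | 0 < p.2 ∧ p.2 • (p.1 : E) ∈ projD x R} := by
      have ho : IsOpen {p : sphere (0 : E) 1 × ℝ | 0 < p.2 ∧ p.2 • (p.1 : E) ∈ projD x R} :=
        (isOpen_lt continuous_const continuous_snd).inter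
          ((projD_isOpen x R).preimage (by fun_prop))
      exact ho.measurableSet
    exact measurable_measure_prodMk_left this
  rw [hgen F hF, hmeas, ← lintegral_const_mul _ hJmeas]
  refine lintegral_mono_ae ?_
  have hfin' : ∀ᵐ θ ∂σ, ρ (J θ) < ⊤ := ae_lt_top hJmeas (hmeas ▸ hfin)
  filter_upwards [hfin'] with θ hθ
  have hθ1 : ‖(θ : E)‖ = 1 := norm_eq_of_mem_sphere θ
  refine auxMax_section ρ hac F (J θ) ⟨‖x‖ + R, fun r hr => ?_⟩ ⟨0, fun r hr => hr.1.le⟩ ‖x‖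
    ?_ ?_ hθ.ne
  · exact projD_bdd x θ hθ1 R hR r hr.1 hr.2
  · intro r hr s h1 h2
    exact ⟨hr.1.trans h1, projD_section_inner x θ hθ1 R r s hr.1 hr.2 h1 h2⟩
  · intro r hr s h1 h2
    exact ⟨(norm_nonneg x).trans_lt h1, projD_section_outer x θ hθ1 R hR r s hr.2 h2 h1⟩

/-- For a rotation invariant absolutely continuous measure `μ = w₀(|x|)dx` on `ℝⁿ` that
is weakly doubling with constant `K₁`, and a radial function `f(x) = f₀(|x|)`, assuming
for every ball `B(x,R)` the existence of a set `D` as in the projection lemma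
(`B(x,R) ⊆ D`, `D` radially convex along rays with `|x|θ ∈ D̄` in every projected
direction, and `μ(D) ≤ (1+K₁) μ(B(x,R))`), one has the pointwise bound
`M_μ f (x) ≤ (1+K₁) M̃_v f₀ (|x|)` with `v(t) = w₀(t) t^(n-1)`, and consequently
the weak type estimate `μ({M_μ f > λ}) ≤ (2(K₁+1)/λ) ‖f‖_{L¹(μ)}`. -/
theorem stmt_17 (n : ℕ) (hn : 1 ≤ n) (w₀ : ℝ → ℝ) (hw : ∀ r : ℝ, 0 ≤ r → 0 < w₀ r)
    (μ : Measure (EuclideanSpace ℝ (Fin n)))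
    (hμ : μ = volume.withDensity fun x => ENNReal.ofReal (w₀ ‖x‖))
    (K₁ : ℝ) (hK₁ : 0 < K₁)
    (hwd : ∀ (x y : EuclideanSpace ℝ (Fin n)) (R : ℝ), 0 < R →
      (ball x R ∩ ball y R).Nonempty →
      μ (ball y R) ≤ ENNReal.ofReal K₁ * μ (ball x R))
    (f : EuclideanSpace ℝ (Fin n) → ℝ) (f₀ : ℝ → ℝ) (hf : ∀ x, f x = f₀ ‖x‖)
    (hD : ∀ (x : EuclideanSpace ℝ (Fin n)) (R : ℝ), 0 < R →
      ∃ D : Set (EuclideanSpace ℝ (Fin n)), MeasurableSet D ∧ ball x R ⊆ D ∧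
        (∀ θ : EuclideanSpace ℝ (Fin n), ‖θ‖ = 1 → (∃ r : ℝ, 0 < r ∧ r • θ ∈ D) →
          ∃ a b : ℝ, 0 ≤ a ∧ a ≤ ‖x‖ ∧ ‖x‖ ≤ b ∧
            ∀ r : ℝ, 0 ≤ r → (r • θ ∈ closure D ↔ a ≤ r ∧ r ≤ b)) ∧
        μ D ≤ ENNReal.ofReal (1 + K₁) * μ (ball x R)) :
    (∀ x : EuclideanSpace ℝ (Fin n),
      centeredMax n μ f x ≤ ENNReal.ofReal (1 + K₁) * oneDimMax w₀ n f₀ ‖x‖) ∧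
    (∀ lam : ℝ, 0 < lam →
      μ {x : EuclideanSpace ℝ (Fin n) | ENNReal.ofReal lam < centeredMax n μ f x}
        ≤ ENNReal.ofReal (2 * (K₁ + 1) / lam) * ∫⁻ x, ‖f x‖₊ ∂μ) := by
  classical
  haveI : Nonempty (Fin n) := ⟨⟨0, hn⟩⟩
  haveI : Nontrivial (EuclideanSpace ℝ (Fin n)) := inferInstance
  set σ := (volume : Measure (EuclideanSpace ℝ (Fin n))).toSphere with hσ
  have hpol0 : IsPolar σ volume (radial (n - 1)) := by
    have := isPolar_volume (volume : Measure (EuclideanSpace ℝ (Fin n)))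
    rwa [finrank_euclideanSpace_fin] at this
  obtain ⟨w₁, hw₁, hwle, hweq, hwμ⟩ := polar_envelope hpol0 (radial_pos _)
    (fun t => ENNReal.ofReal (w₀ t))
  rw [← hwμ] at hμ
  have hw₁t : ∀ t, w₁ t ≠ ⊤ := fun t => ne_top_of_le_ne_top ENNReal.ofReal_ne_top (hwle t)
  set ρ := (radial (n - 1)).withDensity w₁ with hρ
  haveI : SigmaFinite ρ := SigmaFinite.withDensity_of_ne_top (Filter.Eventually.of_forall hw₁t)
  have hpos : ∀ᵐ r ∂ρ, 0 < r := (withDensity_absolutelyContinuous _ _).ae_le (radial_pos _)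
  have hac : ρ ≪ volume := (withDensity_absolutelyContinuous _ _).trans (radial_ac _)
  have hpol : IsPolar σ μ ρ := hμ ▸ isPolar_withDensity hpol0 (radial_pos _) w₁ hw₁
  haveI : SFinite μ := by rw [hμ]; infer_instance
  obtain ⟨F₁, hF₁, hFle, -, hFμ⟩ := polar_envelope hpol hpos (fun t => (‖f₀ t‖₊ : ℝ≥0∞))
  have hfF : ∀ s : Set (EuclideanSpace ℝ (Fin n)), MeasurableSet s →
      ∫⁻ y in s, ‖f y‖₊ ∂μ = ∫⁻ y in s, F₁ ‖y‖ ∂μ := by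
    intro s hs
    simp_rw [hf]
    rw [← withDensity_apply (fun y : EuclideanSpace ℝ (Fin n) => F₁ ‖y‖) hs, hFμ,
      withDensity_apply _ hs]
  have hK : ENNReal.ofReal (1 + K₁) = 1 + ENNReal.ofReal K₁ := by
    rw [ENNReal.ofReal_add zero_le_one hK₁.le, ENNReal.ofReal_one]
  have hmain : ∀ x : EuclideanSpace ℝ (Fin n),
      centeredMax n μ f x ≤ ENNReal.ofReal (1 + K₁) * auxMax ρ F₁ ‖x‖ := by
    intro x
    refine iSup_le fun R => iSup_le fun hR => ?_
    rw [hfF _ measurableSet_ball]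
    by_cases htop : μ (ball x R) = ⊤
    · simp [htop]
    by_cases h0 : μ (ball x R) = 0
    · rw [setLIntegral_measure_zero _ _ h0]; simp
    have hDle := projD_measure μ x R hR (ENNReal.ofReal K₁) (fun y hy => hwd x y R hR hy)
    rw [← hK] at hDle
    have hDfin : μ (projD x R) ≠ ⊤ :=
      ne_top_of_le_ne_top (ENNReal.mul_ne_top ENNReal.ofReal_ne_top htop) hDle
    have hb := polar_ball_bound hpol hpos hac F₁ hF₁ x R hR hDfin
    rw [mul_comm, ← div_eq_mul_inv]
    apply ENNReal.div_le_of_le_mul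
    calc ∫⁻ y in ball x R, F₁ ‖y‖ ∂μ ≤ ∫⁻ y in projD x R, F₁ ‖y‖ ∂μ :=
          lintegral_mono_set Set.subset_union_left
      _ ≤ auxMax ρ F₁ ‖x‖ * μ (projD x R) := hb
      _ ≤ auxMax ρ F₁ ‖x‖ * (ENNReal.ofReal (1 + K₁) * μ (ball x R)) := by gcongr
      _ = _ := by ring
  refine ⟨fun x => (hmain x).trans ?_, fun lam hlam => ?_⟩
  · gcongr
    exact auxMax_le_oneDimMax w₀ f₀ n w₁ F₁ hw₁ hF₁ hwle hFle hweq _ (norm_nonneg x)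
  have hK0 : 0 < 1 + K₁ := by linarith
  set c : ℝ≥0∞ := ENNReal.ofReal (lam / (1 + K₁)) with hc
  obtain ⟨S, hS, hsub, hSle⟩ := auxMax_weak ρ hac F₁ hF₁ c
  have hrad : ∀ G : ℝ → ℝ≥0∞, Measurable G → ∫⁻ y, G ‖y‖ ∂μ = (∫⁻ r, G r ∂ρ) * σ Set.univ := by
    intro G hG
    have hGm : Measurable fun y : EuclideanSpace ℝ (Fin n) => G ‖y‖ := hG.comp measurable_norm
    rw [hpol _ hGm, ← lintegral_const]
    refine lintegral_congr fun θ => lintegral_congr_ae ?_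
    filter_upwards [hpos] with r hr
    rw [norm_smul, norm_eq_of_mem_sphere, Real.norm_of_nonneg hr.le, mul_one]
  have hSm : μ ((fun y => ‖y‖) ⁻¹' S) = ρ S * σ Set.univ := by
    have := hrad (S.indicator 1) (measurable_one.indicator hS)
    rw [lintegral_indicator_one hS] at this
    rw [← this, ← lintegral_indicator_one (hS.preimage measurable_norm)]
    rfl
  have hfint : ∫⁻ x, ‖f x‖₊ ∂μ = (∫⁻ r, F₁ r ∂ρ) * σ Set.univ := by
    rw [← hrad F₁ hF₁]
    simpa using hfF Set.univ MeasurableSet.univ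
  have hcc : ENNReal.ofReal (2 * (K₁ + 1) / lam) * c = 2 := by
    rw [hc, ← ENNReal.ofReal_mul (by positivity)]
    have : 2 * (K₁ + 1) / lam * (lam / (1 + K₁)) = 2 := by field_simp; ring
    rw [this]; simp
  have hc0 : c ≠ 0 := by rw [hc]; simp; positivity
  have hct : c ≠ ⊤ := ENNReal.ofReal_ne_top
  calc μ {x | ENNReal.ofReal lam < centeredMax n μ f x}
      ≤ μ ((fun y => ‖y‖) ⁻¹' S) := by
        apply measure_mono
        intro x hx
        apply hsub
        have hx1 : ENNReal.ofReal lam < ENNReal.ofReal (1 + K₁) * auxMax ρ F₁ ‖x‖ :=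
          lt_of_lt_of_le hx (hmain x)
        show c < auxMax ρ F₁ ‖x‖
        rw [hc, ENNReal.ofReal_div_of_pos hK0]
        exact ENNReal.div_lt_of_lt_mul' hx1
    _ = ρ S * σ Set.univ := hSm
    _ ≤ (c⁻¹ * (2 * ∫⁻ r, F₁ r ∂ρ)) * σ Set.univ := by
        gcongr
        rw [← ENNReal.mul_le_iff_le_inv hc0 hct]
        exact hSle
    _ = _ := by
        rw [hfint, ← mul_assoc, ← mul_assoc]
        congr 2
        rw [← hcc, mul_comm, mul_assoc, ENNReal.mul_inv_cancel hc0 hct, mul_one]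
end
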